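/- arXiv:1707.01155 — 5 statements merged into one kernel-verified Lean document; each statement's English description precedes it below -/
import Mathlib

section
/- If 0 < h < 1/(2L̂), then for every k ≥ 0 the S2CD iterates satisfy E[ P(w^{k+1}) − P(w*) ] ≤ ( (1 − μh)^m / ( (1 − (1 − μh)^m)(1 − 2L̂h) ) + 2L̂h / (1 − 2L̂h) ) · E[ P(w^k) − P(w*) ]. -/
open scoped RealInnerProductSpace BigOperators

noncomputable section

/-- One stochastic inner step of the S2CD algorithm, using the sampled pair
`s = (j, i)` (coordinate `j`, function index `i`):
`y ↦ y − h p_j⁻¹ (∇_j P(w) + (1/(n q_{ij}))(∇_j f_i(y) − ∇_j f_i(w))) e_j`. -/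
def s2cdInnerStep {d n : ℕ}
    (f' : Fin n → EuclideanSpace ℝ (Fin d) → EuclideanSpace ℝ (Fin d))
    (P' : EuclideanSpace ℝ (Fin d) → EuclideanSpace ℝ (Fin d))
    (p : Fin d → ℝ) (q : Fin n → Fin d → ℝ) (h : ℝ)
    (w : EuclideanSpace ℝ (Fin d)) (s : Fin d × Fin n) (y : EuclideanSpace ℝ (Fin d)) :
    EuclideanSpace ℝ (Fin d) :=
  y - (h * (p s.1)⁻¹ *
      ((P' w) s.1 + 1 / ((n : ℝ) * q s.2 s.1) * ((f' s.2 y) s.1 - (f' s.2 w) s.1))) •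
    EuclideanSpace.single s.1 (1 : ℝ)

/-- The result of one S2CD epoch of length `T ≤ m` started at `w`, where the `t`-th inner
step uses the sampled coordinate/index pair `σ t`. -/
def s2cdEpoch {d n : ℕ}
    (f' : Fin n → EuclideanSpace ℝ (Fin d) → EuclideanSpace ℝ (Fin d))
    (P' : EuclideanSpace ℝ (Fin d) → EuclideanSpace ℝ (Fin d))
    (p : Fin d → ℝ) (q : Fin n → Fin d → ℝ) (h : ℝ) (m : ℕ)
    (w : EuclideanSpace ℝ (Fin d)) (T : ℕ) (σ : Fin m → Fin d × Fin n) :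
    EuclideanSpace ℝ (Fin d) :=
  (List.finRange m).foldl
    (fun y (t : Fin m) =>
      if (t : ℕ) < T then s2cdInnerStep f' P' p q h w (σ t) y else y) w

/-- The iterate `w^k` produced by `k` epochs of S2CD started from `w0`, given the random
seed `ω`: in epoch `j`, the epoch length is `(ω j).1 + 1 ∈ {1, …, m}` and the sampled
coordinate/index pairs are given by `(ω j).2`. -/
def s2cdIterate {d n : ℕ}
    (f' : Fin n → EuclideanSpace ℝ (Fin d) → EuclideanSpace ℝ (Fin d))
    (P' : EuclideanSpace ℝ (Fin d) → EuclideanSpace ℝ (Fin d))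
    (p : Fin d → ℝ) (q : Fin n → Fin d → ℝ) (h : ℝ) (m : ℕ)
    (w0 : EuclideanSpace ℝ (Fin d)) (k : ℕ)
    (ω : Fin k → Fin m × (Fin m → Fin d × Fin n)) : EuclideanSpace ℝ (Fin d) :=
  (List.finRange k).foldl
    (fun w j => s2cdEpoch f' P' p q h m w (((ω j).1 : ℕ) + 1) (ω j).2) w0

/-- The probability of the random seed `ω` of `k` epochs of S2CD: the epoch length `T+1`
has probability `(1 − μh)^{m−(T+1)} / β`, and each sampled pair `(j, i)` has probability
`p_j q_{ij}`. -/
def s2cdWeight {d n : ℕ} (μ h β : ℝ) (p : Fin d → ℝ) (q : Fin n → Fin d → ℝ) (m : ℕ)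
    {k : ℕ} (ω : Fin k → Fin m × (Fin m → Fin d × Fin n)) : ℝ :=
  ∏ j, (((1 - μ * h) ^ (m - (((ω j).1 : ℕ) + 1)) / β) *
    ∏ t, (p ((ω j).2 t).1 * q ((ω j).2 t).2 ((ω j).2 t).1))

/-- The averaging operator `F ↦ (x ↦ ∑ s, π s * F (step s x))`. -/
def avgOp {S X : Type*} [Fintype S] (π : S → ℝ) (step : S → X → X) : Module.End ℝ (X → ℝ) where
  toFun F := fun x => ∑ s, π s * F (step s x)
  map_add' F G := by
    funext x
    simp [mul_add, Finset.sum_add_distrib]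
  map_smul' c F := by
    funext x
    simp only [Pi.smul_apply, smul_eq_mul, RingHom.id_apply, Finset.mul_sum]
    refine Finset.sum_congr rfl fun s _ => by ring

theorem avgOp_apply {S X : Type*} [Fintype S] (π : S → ℝ) (step : S → X → X)
    (F : X → ℝ) (x : X) : avgOp π step F x = ∑ s, π s * F (step s x) := rfl

theorem avgOp_pow_mono {S X : Type*} [Fintype S] (π : S → ℝ) (hπ : ∀ s, 0 ≤ π s)
    (step : S → X → X) (t : ℕ) : ∀ (F G : X → ℝ), (∀ x, F x ≤ G x) →
      ∀ x, (avgOp π step ^ t) F x ≤ (avgOp π step ^ t) G x := by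
  induction t with
  | zero => intro F G hFG x; simpa using hFG x
  | succ t ih =>
    intro F G hFG x
    rw [pow_succ, Module.End.mul_apply, Module.End.mul_apply]
    refine ih _ _ (fun y => ?_) x
    rw [avgOp_apply, avgOp_apply]
    exact Finset.sum_le_sum fun s _ => mul_le_mul_of_nonneg_left (hFG _) (hπ s)

theorem avgOp_pow_const {S X : Type*} [Fintype S] (π : S → ℝ) (hπ : ∑ s, π s = 1)
    (step : S → X → X) (t : ℕ) (c : ℝ) (x : X) :
      (avgOp π step ^ t) (fun _ => c) x = c := by
  induction t with
  | zero => simp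
  | succ t ih =>
    rw [pow_succ, Module.End.mul_apply]
    have : avgOp π step (fun _ => c) = fun _ => c := by
      funext y
      rw [avgOp_apply, ← Finset.sum_mul, hπ, one_mul]
    rw [this, ih]

theorem sum_fin_succ_fun {S : Type*} [Fintype S] (m : ℕ) (G : (Fin (m + 1) → S) → ℝ) :
    ∑ σ, G σ = ∑ s, ∑ σ : Fin m → S, G (Fin.cons s σ) := by
  rw [← (Fin.consEquiv (fun _ : Fin (m + 1) => S)).sum_comp, Fintype.sum_prod_type]
  rfl

theorem sum_foldl {S X : Type*} [Fintype S] (π : S → ℝ) (step : S → X → X) (F : X → ℝ)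
    (k : ℕ) : ∀ x : X,
    ∑ σ : Fin k → S, (∏ t, π (σ t)) *
      F ((List.finRange k).foldl (fun y t => step (σ t) y) x) = (avgOp π step ^ k) F x := by
  induction k with
  | zero => intro x; simp
  | succ k ih =>
    intro x
    rw [sum_fin_succ_fun, pow_succ', Module.End.mul_apply, avgOp_apply]
    refine Finset.sum_congr rfl fun s _ => ?_
    rw [← ih, Finset.mul_sum]
    refine Finset.sum_congr rfl fun σ _ => ?_
    rw [List.finRange_succ, List.foldl_cons, List.foldl_map, Fin.prod_univ_succ]
    simp only [Fin.cons_zero, Fin.cons_succ]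
    ring

theorem sum_foldl_trunc {S X : Type*} [Fintype S] (π : S → ℝ) (hπ : ∑ s, π s = 1)
    (step : S → X → X) (F : X → ℝ)
    (k : ℕ) : ∀ (T : ℕ), T ≤ k → ∀ x : X,
    ∑ σ : Fin k → S, (∏ t, π (σ t)) *
      F ((List.finRange k).foldl (fun y (t : Fin k) => if (t : ℕ) < T then step (σ t) y else y) x)
        = (avgOp π step ^ T) F x := by
  induction k with
  | zero => intro T hT x; obtain rfl : T = 0 := by omega
            simp
  | succ k ih =>
    intro T hT x
    rw [sum_fin_succ_fun]
    cases T with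
    | zero =>
      have key : ∀ s, ∑ σ : Fin k → S, (∏ t, π ((Fin.cons s σ : Fin (k + 1) → S) t)) *
          F ((List.finRange (k + 1)).foldl (fun y (t : Fin (k + 1)) => if (t : ℕ) < 0 then
            step ((Fin.cons s σ : Fin (k + 1) → S) t) y else y) x) = π s * F x := by
        intro s
        have h0 := ih 0 (Nat.zero_le _) x
        simp only [pow_zero, Module.End.one_apply] at h0
        rw [← h0, Finset.mul_sum]
        refine Finset.sum_congr rfl fun σ _ => ?_
        rw [List.finRange_succ, List.foldl_cons, List.foldl_map, Fin.prod_univ_succ]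
        simp only [Fin.cons_zero, Fin.cons_succ, Nat.not_lt_zero, if_false]
        ring
      rw [Finset.sum_congr rfl fun s _ => key s, ← Finset.sum_mul, hπ]
      simp
    | succ T =>
      rw [pow_succ', Module.End.mul_apply, avgOp_apply]
      refine Finset.sum_congr rfl fun s _ => ?_
      rw [← ih T (by omega), Finset.mul_sum]
      refine Finset.sum_congr rfl fun σ _ => ?_
      rw [List.finRange_succ, List.foldl_cons, List.foldl_map, Fin.prod_univ_succ]
      simp only [Fin.cons_zero, Fin.cons_succ, Fin.val_succ, Fin.val_zero, Nat.succ_pos, if_true,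
        Nat.add_lt_add_iff_right]
      ring

/-- The scalar recursion. -/
theorem seq_bound (ρ c e : ℝ) (hρ : 0 ≤ ρ) (B r : ℕ → ℝ)
    (hrec : ∀ t, r (t + 1) + c * B t ≤ ρ * r t + e) (M : ℕ) :
    r (M + 1) + c * ∑ t ∈ Finset.range M, ρ ^ (M - (t + 1)) * B (t + 1)
      ≤ ρ ^ M * r 1 + e * ∑ t ∈ Finset.range M, ρ ^ (M - (t + 1)) := by
  induction M with
  | zero => simp
  | succ M ih =>
    have h1 : ∑ t ∈ Finset.range M, ρ ^ (M + 1 - (t + 1)) * B (t + 1)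
        = ρ * ∑ t ∈ Finset.range M, ρ ^ (M - (t + 1)) * B (t + 1) := by
      rw [Finset.mul_sum]
      refine Finset.sum_congr rfl fun t ht => ?_
      have := Finset.mem_range.1 ht
      rw [show M + 1 - (t + 1) = (M - (t + 1)) + 1 by omega, pow_succ]; ring
    have h2 : ∑ t ∈ Finset.range M, ρ ^ (M + 1 - (t + 1))
        = ρ * ∑ t ∈ Finset.range M, ρ ^ (M - (t + 1)) := by
      rw [Finset.mul_sum]
      refine Finset.sum_congr rfl fun t ht => ?_
      have := Finset.mem_range.1 ht
      rw [show M + 1 - (t + 1) = (M - (t + 1)) + 1 by omega, pow_succ]; ring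
    rw [Finset.sum_range_succ, Finset.sum_range_succ, h1, h2]
    simp only [Nat.sub_self, pow_zero, one_mul]
    have h3 := hrec (M + 1)
    have h4 := mul_le_mul_of_nonneg_left ih hρ
    rw [pow_succ]
    linarith

theorem geom_aux (ρ : ℝ) (M : ℕ) :
    (1 - ρ) * ∑ t ∈ Finset.range M, ρ ^ (M - (t + 1)) = 1 - ρ ^ M := by
  have : ∑ t ∈ Finset.range M, ρ ^ (M - (t + 1)) = ∑ t ∈ Finset.range M, ρ ^ t := by
    rw [← Finset.sum_range_reflect (fun t => ρ ^ t)]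
    refine Finset.sum_congr rfl fun t ht => ?_
    congr 1; omega
  rw [this, mul_comm, geom_sum_mul_neg]

/-- First order characterization of convexity. -/
theorem convex_first_order {E : Type*} [NormedAddCommGroup E] [InnerProductSpace ℝ E]
    [CompleteSpace E] (f : E → ℝ) (hf : ConvexOn ℝ Set.univ f) (g x z : E)
    (hg : HasGradientAt f g x) : f x + ⟪g, z - x⟫ ≤ f z := by
  have hc : ConvexOn ℝ Set.univ (fun t : ℝ => f (AffineMap.lineMap x z t)) := by
    have := hf.comp_affineMap (AffineMap.lineMap x z : ℝ →ᵃ[ℝ] E)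
    simp only [Set.preimage_univ] at this
    exact this
  have hd : HasDerivAt (fun t : ℝ => f (AffineMap.lineMap x z t)) ⟪g, z - x⟫ 0 := by
    have h1 : HasFDerivAt f (InnerProductSpace.toDual ℝ E g) (AffineMap.lineMap x z (0:ℝ)) := by
      simpa using hg.hasFDerivAt
    have h2 : HasDerivAt (fun t : ℝ => (AffineMap.lineMap x z t : E)) (z - x) 0 :=
      AffineMap.hasDerivAt_lineMap
    have h3 := h1.comp_hasDerivAt (0:ℝ) h2
    simp only [InnerProductSpace.toDual_apply_apply] at h3
    exact h3
  have := hc.le_slope_of_hasDerivAt (Set.mem_univ 0) (Set.mem_univ 1) one_pos hd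
  simp [slope_def_field] at this
  linarith

/-- Second moment bound, general case. -/
theorem second_moment {ι : Type*} [Fintype ι] (N : ℝ) (q a b : ι → ℝ)
    (hq : ∀ i, 0 ≤ q i) (hq1 : ∑ i, q i = 1) (hN : N ≠ 0)
    (hb : ∀ i, q i = 0 → b i = 0) (B : ℝ) (hB : B = 1 / N * ∑ i, b i) :
    ∑ i, q i * (B + 1 / (N * q i) * (a i - b i)) ^ 2
      ≤ 2 * ∑ i, a i ^ 2 / (N ^ 2 * q i) + 2 * ∑ i, b i ^ 2 / (N ^ 2 * q i) - 2 * B ^ 2 := by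
  have e1 : ∑ i, b i / N = B := by rw [hB, ← Finset.sum_div]; ring
  have key : ∀ i, q i * (B + 1 / (N * q i) * (a i - b i)) ^ 2
      ≤ 2 * (a i ^ 2 / (N ^ 2 * q i)) + 2 * (b i ^ 2 / (N ^ 2 * q i)) - 4 * B * (b i / N)
        + 2 * B ^ 2 * q i := by
    intro i
    rcases (hq i).eq_or_lt with h0 | h0
    · simp [← h0, hb i h0.symm]
    · have t1 : a i ^ 2 / (N ^ 2 * q i) = q i * (a i / (N * q i)) ^ 2 := by
        field_simp
      have t2 : b i ^ 2 / (N ^ 2 * q i) = q i * (b i / (N * q i)) ^ 2 := by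
        field_simp
      have t3 : b i / N = q i * (b i / (N * q i)) := by field_simp
      have t4 : 1 / (N * q i) * (a i - b i) = a i / (N * q i) - b i / (N * q i) := by ring
      rw [t1, t2, t3, t4]
      nlinarith [mul_nonneg h0.le (sq_nonneg (a i / (N * q i) + (b i / (N * q i) - B)))]
  refine (Finset.sum_le_sum fun i _ => key i).trans ?_
  rw [Finset.sum_add_distrib, Finset.sum_sub_distrib, Finset.sum_add_distrib, ← Finset.mul_sum,
    ← Finset.mul_sum, ← Finset.mul_sum, ← Finset.mul_sum, e1, hq1]
  linarith

/-- Jensen. -/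
theorem mean_sq_le {ι : Type*} [Fintype ι] (N : ℝ) (q b : ι → ℝ)
    (hq : ∀ i, 0 ≤ q i) (hq1 : ∑ i, q i = 1) (hN : N ≠ 0)
    (hb : ∀ i, q i = 0 → b i = 0) (B : ℝ) (hB : B = 1 / N * ∑ i, b i) :
    B ^ 2 ≤ ∑ i, b i ^ 2 / (N ^ 2 * q i) := by
  have e1 : ∑ i, b i / N = B := by rw [hB, ← Finset.sum_div]; ring
  have key : ∀ i, 2 * B * (b i / N) - B ^ 2 * q i ≤ b i ^ 2 / (N ^ 2 * q i) := by
    intro i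
    rcases (hq i).eq_or_lt with h0 | h0
    · simp [← h0, hb i h0.symm]
    · have t2 : b i ^ 2 / (N ^ 2 * q i) = q i * (b i / (N * q i)) ^ 2 := by
        field_simp
      have t3 : b i / N = q i * (b i / (N * q i)) := by field_simp
      rw [t2, t3]
      nlinarith [mul_nonneg h0.le (sq_nonneg (b i / (N * q i) - B))]
  have := Finset.sum_le_sum fun i (_ : i ∈ Finset.univ) => key i
  rw [Finset.sum_sub_distrib, ← Finset.mul_sum, ← Finset.mul_sum, e1, hq1] at this
  linarith

theorem grad_gap {d : ℕ} (f : EuclideanSpace ℝ (Fin d) → ℝ)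
    (f' : EuclideanSpace ℝ (Fin d) → EuclideanSpace ℝ (Fin d))
    (hgrad : ∀ x, HasGradientAt f (f' x) x) (hconvex : ConvexOn ℝ Set.univ f)
    (j : Fin d) (L : ℝ) (hL : 0 < L)
    (hs : ∀ (x : EuclideanSpace ℝ (Fin d)) (t : ℝ),
      f (x + t • EuclideanSpace.single j (1 : ℝ)) ≤ f x + t * (f' x) j + L / 2 * t ^ 2)
    (x w : EuclideanSpace ℝ (Fin d)) :
    ((f' x) j - (f' w) j) ^ 2 / L ≤ 2 * (f x - f w - ⟪f' w, x - w⟫) := by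
  set D := (f' x) j - (f' w) j with hD
  have h1 := hs x (-(D / L))
  have h2 := convex_first_order f hconvex (f' w) w
    (x + (-(D / L)) • EuclideanSpace.single j (1 : ℝ)) (hgrad w)
  have h3 : ⟪f' w, x + (-(D / L)) • EuclideanSpace.single j (1 : ℝ) - w⟫
      = ⟪f' w, x - w⟫ - D / L * (f' w) j := by
    rw [add_sub_right_comm, inner_add_right, inner_smul_right, EuclideanSpace.inner_single_right]
    simp
    ring
  rw [h3] at h2
  have h4 : D / L * D - L / 2 * (D / L) ^ 2 = D ^ 2 / L / 2 := by field_simp; ring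
  have h5 : D / L * D = D / L * (f' x) j - D / L * (f' w) j := by rw [hD]; ring
  linarith [neg_sq (D / L)]

theorem one_step {d n : ℕ} (hn : 0 < n)
    (f' : Fin n → EuclideanSpace ℝ (Fin d) → EuclideanSpace ℝ (Fin d))
    (P : EuclideanSpace ℝ (Fin d) → ℝ)
    (P' : EuclideanSpace ℝ (Fin d) → EuclideanSpace ℝ (Fin d))
    (hP' : ∀ w, P' w = (1 / (n : ℝ)) • ∑ i, f' i w)
    (μ : ℝ) (hstrong : ∀ x z : EuclideanSpace ℝ (Fin d),
      P x + ⟪P' x, z - x⟫ + μ / 2 * ‖z - x‖ ^ 2 ≤ P z)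
    (ws : EuclideanSpace ℝ (Fin d)) (hws : P' ws = 0)
    (p : Fin d → ℝ) (q : Fin n → Fin d → ℝ) (hp : ∀ j, 0 < p j) (hp1 : ∑ j, p j = 1)
    (hq : ∀ i j, 0 ≤ q i j) (hq1 : ∀ j, ∑ i, q i j = 1)
    (hq0 : ∀ i j, q i j = 0 → ∀ x y, (f' i x) j = (f' i y) j)
    (Lh : ℝ)
    (hgap : ∀ x, ∑ j, (p j)⁻¹ * ∑ i, ((f' i x) j - (f' i ws) j) ^ 2 / ((n : ℝ) ^ 2 * q i j)
      ≤ 2 * Lh * (P x - P ws))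
    (h : ℝ) (hh : 0 < h) (w : EuclideanSpace ℝ (Fin d)) :
    (∀ y, avgOp (fun s : Fin d × Fin n => p s.1 * q s.2 s.1) (s2cdInnerStep f' P' p q h w)
        (fun y => ‖y - ws‖ ^ 2) y
      ≤ (1 - μ * h) * ‖y - ws‖ ^ 2 - 2 * h * (P y - P ws)
        + h ^ 2 * (4 * Lh * (P y - P ws) + 4 * Lh * (P w - P ws))) ∧
    avgOp (fun s : Fin d × Fin n => p s.1 * q s.2 s.1) (s2cdInnerStep f' P' p q h w)
        (fun y => ‖y - ws‖ ^ 2) w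
      ≤ (1 - μ * h) * ‖w - ws‖ ^ 2 - 2 * h * (P w - P ws) + h ^ 2 * (2 * Lh * (P w - P ws)) := by
  have hN : (n : ℝ) ≠ 0 := by positivity
  have hP'j : ∀ x j, (P' x) j = 1 / (n : ℝ) * ∑ i, (f' i x) j := by
    intro x j; rw [hP']; simp
  have hPb : ∀ x j, (P' x) j = 1 / (n : ℝ) * ∑ i, ((f' i x) j - (f' i ws) j) := by
    intro x j
    have : (P' ws) j = 0 := by rw [hws]; simp
    rw [hP'j] at this
    rw [Finset.sum_sub_distrib, mul_sub, this, hP'j]; ring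
  have hmean : ∀ y j, ∑ i, q i j * ((P' w) j + 1 / ((n : ℝ) * q i j) *
      ((f' i y) j - (f' i w) j)) = (P' y) j := by
    intro y j
    have : ∀ i, q i j * ((P' w) j + 1 / ((n : ℝ) * q i j) * ((f' i y) j - (f' i w) j))
        = q i j * (P' w) j + 1 / (n : ℝ) * ((f' i y) j - (f' i w) j) := by
      intro i
      by_cases h0 : q i j = 0
      · rw [hq0 i j h0 y w, h0]; simp
      · field_simp
    rw [Finset.sum_congr rfl fun i _ => this i, Finset.sum_add_distrib, ← Finset.sum_mul, hq1,
      ← Finset.mul_sum, Finset.sum_sub_distrib, hP'j y, hP'j w]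
    ring
  have hexp : ∀ y, avgOp (fun s : Fin d × Fin n => p s.1 * q s.2 s.1)
      (s2cdInnerStep f' P' p q h w) (fun y => ‖y - ws‖ ^ 2) y
      = ‖y - ws‖ ^ 2 - 2 * h * ⟪P' y, y - ws⟫ + h ^ 2 * ∑ j, (p j)⁻¹ * ∑ i, q i j *
        ((P' w) j + 1 / ((n : ℝ) * q i j) * ((f' i y) j - (f' i w) j)) ^ 2 := by
    intro y
    rw [avgOp_apply, Fintype.sum_prod_type]
    have hterm : ∀ j, ∑ i, p j * q i j * ‖s2cdInnerStep f' P' p q h w (j, i) y - ws‖ ^ 2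
        = p j * ‖y - ws‖ ^ 2 - 2 * h * ((y - ws) j * (P' y) j) +
          h ^ 2 * ((p j)⁻¹ * ∑ i, q i j *
        ((P' w) j + 1 / ((n : ℝ) * q i j) * ((f' i y) j - (f' i w) j)) ^ 2) := by
      intro j
      have hpj := (hp j).ne'
      have : ∀ i, p j * q i j * ‖s2cdInnerStep f' P' p q h w (j, i) y - ws‖ ^ 2
          = q i j * (p j * ‖y - ws‖ ^ 2) - 2 * h * (y - ws) j *
            (q i j * ((P' w) j + 1 / ((n : ℝ) * q i j) * ((f' i y) j - (f' i w) j)))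
            + h ^ 2 * (p j)⁻¹ * (q i j *
              ((P' w) j + 1 / ((n : ℝ) * q i j) * ((f' i y) j - (f' i w) j)) ^ 2) := by
        intro i
        unfold s2cdInnerStep
        simp only
        generalize (P' w) j + 1 / ((n : ℝ) * q i j) * ((f' i y) j - (f' i w) j) = G
        rw [sub_right_comm, norm_sub_sq_real, inner_smul_right, EuclideanSpace.inner_single_right,
          norm_smul, mul_pow]
        simp only [PiLp.norm_single, Real.norm_eq_abs, sq_abs, abs_one, one_pow, conj_trivial]
        field_simp
      rw [Finset.sum_congr rfl fun i _ => this i, Finset.sum_add_distrib, Finset.sum_sub_distrib,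
        ← Finset.sum_mul, hq1, ← Finset.mul_sum, hmean, ← Finset.mul_sum]
      ring
    rw [Finset.sum_congr rfl fun j _ => hterm j, Finset.sum_add_distrib, Finset.sum_sub_distrib,
      ← Finset.sum_mul, hp1, ← Finset.mul_sum, ← Finset.mul_sum, PiLp.inner_apply]
    simp
  have hsc : ∀ y, P y - P ws + μ / 2 * ‖y - ws‖ ^ 2 ≤ ⟪P' y, y - ws⟫ := by
    intro y
    have h1 := hstrong y ws
    rw [norm_sub_rev, ← neg_sub y ws, inner_neg_right] at h1
    linarith
  constructor
  · intro y
    rw [hexp]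
    have hvar : ∑ j, (p j)⁻¹ * ∑ i, q i j *
        ((P' w) j + 1 / ((n : ℝ) * q i j) * ((f' i y) j - (f' i w) j)) ^ 2
        ≤ 4 * Lh * (P y - P ws) + 4 * Lh * (P w - P ws) := by
      have hj : ∀ j, (p j)⁻¹ * ∑ i, q i j *
        ((P' w) j + 1 / ((n : ℝ) * q i j) * ((f' i y) j - (f' i w) j)) ^ 2 ≤
          2 * ((p j)⁻¹ * ∑ i, ((f' i y) j - (f' i ws) j) ^ 2 / ((n : ℝ) ^ 2 * q i j)) +
          2 * ((p j)⁻¹ * ∑ i, ((f' i w) j - (f' i ws) j) ^ 2 / ((n : ℝ) ^ 2 * q i j)) := by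
        intro j
        have := second_moment (n : ℝ) (fun i => q i j) (fun i => (f' i y) j - (f' i ws) j)
          (fun i => (f' i w) j - (f' i ws) j) (fun i => hq i j) (hq1 j) hN
          (fun i h0 => by simp only [hq0 i j h0 w ws, sub_self]) _ (hPb w j)
        simp only [sub_sub_sub_cancel_right] at this
        have h2 := mul_le_mul_of_nonneg_left
          (this.trans (sub_le_self _ (by positivity))) (inv_nonneg.2 (hp j).le)
        linarith
      have := Finset.sum_le_sum fun j (_ : j ∈ Finset.univ) => hj j
      rw [Finset.sum_add_distrib, ← Finset.mul_sum, ← Finset.mul_sum] at this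
      linarith [hgap y, hgap w]
    have := mul_le_mul_of_nonneg_left hvar (sq_nonneg h)
    have h3 := mul_le_mul_of_nonneg_left (hsc y) hh.le
    linarith
  · rw [hexp]
    have hvar : ∑ j, (p j)⁻¹ * ∑ i, q i j *
        ((P' w) j + 1 / ((n : ℝ) * q i j) * ((f' i w) j - (f' i w) j)) ^ 2
        ≤ 2 * Lh * (P w - P ws) := by
      refine le_trans (Finset.sum_le_sum fun j _ => ?_) (hgap w)
      refine mul_le_mul_of_nonneg_left ?_ (inv_nonneg.2 (hp j).le)
      simp only [sub_self, mul_zero, add_zero]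
      rw [← Finset.sum_mul, hq1, one_mul]
      exact mean_sq_le (n : ℝ) (fun i => q i j) 
          (fun i => (f' i w) j - (f' i ws) j) (fun i => hq i j) (hq1 j) hN
          (fun i h0 => by simp only [hq0 i j h0 w ws, sub_self]) _ (hPb w j)
    have := mul_le_mul_of_nonneg_left hvar (sq_nonneg h)
    have h3 := mul_le_mul_of_nonneg_left (hsc w) hh.le
    linarith

/-- One epoch contracts the expected suboptimality. -/
theorem epoch_bound {X S : Type*} [Fintype S] (π : S → ℝ) (hπ : ∀ s, 0 ≤ π s)
    (hπ1 : ∑ s, π s = 1) (step : S → X → X) (A R : X → ℝ) (w : X)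
    (μ h Lh : ℝ) (hμ : 0 < μ) (hh : 0 < h) (hLh : 0 < Lh) (hhL : 2 * Lh * h < 1)
    (hμh : μ * h ≤ 1) (hA : ∀ y, 0 ≤ A y) (hR : ∀ y, 0 ≤ R y) (hRw : μ / 2 * R w ≤ A w)
    (h1 : ∀ y, avgOp π step R y ≤ (1 - μ * h) * R y - 2 * h * A y
      + h ^ 2 * (4 * Lh * A y + 4 * Lh * A w))
    (h2 : avgOp π step R w ≤ (1 - μ * h) * R w - 2 * h * A w + h ^ 2 * (2 * Lh * A w))
    (m : ℕ) (hm : 1 ≤ m) (β : ℝ)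
    (hβ : β = ∑ t ∈ Finset.range m, (1 - μ * h) ^ (m - (t + 1))) :
    ∑ t ∈ Finset.range m, (1 - μ * h) ^ (m - (t + 1)) / β * (avgOp π step ^ (t + 1)) A w
      ≤ ((1 - μ * h) ^ m / ((1 - (1 - μ * h) ^ m) * (1 - 2 * Lh * h))
        + 2 * Lh * h / (1 - 2 * Lh * h)) * A w := by
  set ρ := 1 - μ * h with hρ
  have hμh0 : 0 < μ * h := mul_pos hμ hh
  have hρ0 : 0 ≤ ρ := by linarith
  have hρ1 : ρ < 1 := by linarith
  have hρm : ρ ^ m < 1 := pow_lt_one₀ hρ0 hρ1 (by omega)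
  set c := 2 * h * (1 - 2 * Lh * h) with hc
  have hc0 : 0 < c := by have : 0 < 1 - 2 * Lh * h := by linarith
                         positivity
  set e := 4 * Lh * h ^ 2 * A w with he
  have hpt : ∀ y, avgOp π step R y ≤ (ρ • R + (-c) • A + (fun _ => e) : X → ℝ) y := by
    intro y
    simp only [Pi.add_apply, Pi.smul_apply, smul_eq_mul]
    refine (h1 y).trans (le_of_eq ?_)
    rw [hc, he]; ring
  have hrec : ∀ t, (avgOp π step ^ (t + 1)) R w + c * (avgOp π step ^ t) A w
      ≤ ρ * (avgOp π step ^ t) R w + e := by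
    intro t
    have := avgOp_pow_mono π hπ step t _ _ hpt w
    rw [map_add, map_add, map_smul, map_smul] at this
    simp only [Pi.add_apply, Pi.smul_apply, smul_eq_mul] at this
    rw [avgOp_pow_const π hπ1] at this
    rw [pow_succ, Module.End.mul_apply]
    linarith
  have hmain := seq_bound ρ c e hρ0 (fun t => (avgOp π step ^ t) A w)
    (fun t => (avgOp π step ^ t) R w) hrec m

  rw [← hβ] at hmain
  have hr0 : 0 ≤ (avgOp π step ^ (m + 1)) R w := by
    have := avgOp_pow_mono π hπ step (m + 1) (fun _ => 0) R hR w
    rwa [avgOp_pow_const π hπ1] at this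
  have hr1 : (avgOp π step ^ 1) R w ≤ 2 / μ * A w := by
    rw [pow_one]
    have e1 : R w ≤ 2 / μ * A w := by
      rw [div_mul_eq_mul_div, le_div_iff₀ hμ]; linarith
    have e2 : ρ * R w ≤ R w := by nlinarith [hR w]
    have e3 : 0 ≤ (h * A w) * (1 - Lh * h) :=
      mul_nonneg (mul_nonneg hh.le (hA w)) (by nlinarith)
    nlinarith
  have hgeo := geom_aux ρ m
  rw [← hβ] at hgeo
  have hβv : β = (1 - ρ ^ m) / (μ * h) := by
    rw [eq_div_iff hμh0.ne', ← hgeo, hρ]; ring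
  have hβ0 : 0 < β := by rw [hβv]; exact div_pos (by linarith) hμh0
  have hb : c * ∑ t ∈ Finset.range m, ρ ^ (m - (t + 1)) * (avgOp π step ^ (t + 1)) A w
      ≤ ρ ^ m * (2 / μ * A w) + e * β := by
    have := mul_le_mul_of_nonneg_left hr1 (pow_nonneg hρ0 m)
    linarith
  have hsum : ∑ t ∈ Finset.range m, ρ ^ (m - (t + 1)) / β * (avgOp π step ^ (t + 1)) A w
      = (∑ t ∈ Finset.range m, ρ ^ (m - (t + 1)) * (avgOp π step ^ (t + 1)) A w) / β := by
    rw [Finset.sum_div]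
    exact Finset.sum_congr rfl fun t _ => by ring
  rw [hsum, div_le_iff₀ hβ0]
  refine le_of_mul_le_mul_left (hb.trans (le_of_eq ?_)) hc0
  have n1 : 1 - ρ ^ m ≠ 0 := by linarith
  have n2 : 1 - 2 * Lh * h ≠ 0 := by linarith
  rw [hβv, he, hc]
  field_simp
  ring

/-- **Linear convergence of S2CD** (Theorem 3.2 of Konečný's thesis).
If `0 < h < 1/(2L̂)` (and `μh ≤ 1`), then for every `k ≥ 0` the S2CD iterates satisfy
`E[P(w^{k+1}) − P(w*)] ≤ ((1−μh)^m/((1−(1−μh)^m)(1−2L̂h)) + 2L̂h/(1−2L̂h)) ·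
E[P(w^k) − P(w*)]`. -/
theorem s2cd_linear_convergence
    (d n : ℕ) (hn : 0 < n) (hd : 0 < d)
    (f : Fin n → EuclideanSpace ℝ (Fin d) → ℝ)
    (f' : Fin n → EuclideanSpace ℝ (Fin d) → EuclideanSpace ℝ (Fin d))
    (hgrad : ∀ i x, HasGradientAt (f i) (f' i x) x)
    (hconvex : ∀ i, ConvexOn ℝ Set.univ (f i))
    (Lmat : Fin n → Fin d → ℝ) (hLnn : ∀ i j, 0 ≤ Lmat i j)
    (hLsmooth : ∀ (i : Fin n) (j : Fin d) (x : EuclideanSpace ℝ (Fin d)) (t : ℝ),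
      f i (x + t • EuclideanSpace.single j (1 : ℝ))
        ≤ f i x + t * (f' i x) j + Lmat i j / 2 * t ^ 2)
    (hLzero : ∀ i j, Lmat i j = 0 → ∀ x y, (f' i x) j = (f' i y) j)
    (hcol : ∀ j, ∃ i, 0 < Lmat i j)
    (P : EuclideanSpace ℝ (Fin d) → ℝ)
    (hP : ∀ w, P w = (1 / (n : ℝ)) * ∑ i, f i w)
    (P' : EuclideanSpace ℝ (Fin d) → EuclideanSpace ℝ (Fin d))
    (hP' : ∀ w, P' w = (1 / (n : ℝ)) • ∑ i, f' i w)
    (μ : ℝ) (hμ : 0 < μ)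
    (hstrong : ∀ x z : EuclideanSpace ℝ (Fin d),
      P x + ⟪P' x, z - x⟫ + μ / 2 * ‖z - x‖ ^ 2 ≤ P z)
    (wstar : EuclideanSpace ℝ (Fin d)) (hmin : ∀ w, P wstar ≤ P w)
    (ωc : Fin n → ℝ) (hωc : ∀ i, ωc i = ({j | 0 < Lmat i j}.ncard : ℝ))
    (v : Fin d → ℝ) (hv : ∀ j, v j = ∑ i, ωc i * Lmat i j)
    (p : Fin d → ℝ) (hp : ∀ j, p j = v j / ∑ j', v j')
    (q : Fin n → Fin d → ℝ) (hq : ∀ i j, q i j = ωc i * Lmat i j / v j)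
    (Lhat : ℝ) (hLhat : Lhat = (1 / (n : ℝ)) * ∑ j, v j)
    (m : ℕ) (hm : 1 ≤ m) (h : ℝ)
    (hh0 : 0 < h) (hhL : h < 1 / (2 * Lhat)) (hμh : μ * h ≤ 1)
    (β : ℝ) (hβ : β = ∑ t ∈ Finset.range m, (1 - μ * h) ^ (m - (t + 1)))
    (chat : ℝ)
    (hchat : chat = (1 - μ * h) ^ m / ((1 - (1 - μ * h) ^ m) * (1 - 2 * Lhat * h))
        + 2 * Lhat * h / (1 - 2 * Lhat * h))
    (w0 : EuclideanSpace ℝ (Fin d)) (k : ℕ) :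
    ∑ ω : Fin (k + 1) → Fin m × (Fin m → Fin d × Fin n),
        s2cdWeight μ h β p q m ω * (P (s2cdIterate f' P' p q h m w0 (k + 1) ω) - P wstar)
      ≤ chat *
        ∑ ω : Fin k → Fin m × (Fin m → Fin d × Fin n),
          s2cdWeight μ h β p q m ω * (P (s2cdIterate f' P' p q h m w0 k ω) - P wstar) := by
  have hN0 : (0 : ℝ) < n := by exact_mod_cast hn
  have hω1 : ∀ i j, 0 < Lmat i j → 0 < ωc i := by
    intro i j hij
    rw [hωc]
    have : 0 < {j | 0 < Lmat i j}.ncard := (Set.ncard_pos (Set.toFinite _)).2 ⟨j, hij⟩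
    exact_mod_cast this
  have hω0 : ∀ i, 0 ≤ ωc i := fun i => by rw [hωc]; positivity
  have hv0 : ∀ j, 0 < v j := by
    intro j
    obtain ⟨i, hi⟩ := hcol j
    rw [hv]
    exact Finset.sum_pos' (fun i _ => mul_nonneg (hω0 i) (hLnn i j))
      ⟨i, Finset.mem_univ _, mul_pos (hω1 i j hi) hi⟩
  have hV : 0 < ∑ j, v j :=
    Finset.sum_pos (fun j _ => hv0 j) ⟨⟨0, hd⟩, Finset.mem_univ _⟩
  have hL0 : 0 < Lhat := by rw [hLhat]; positivity
  have hhL' : 2 * Lhat * h < 1 := by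
    rw [lt_div_iff₀ (by positivity)] at hhL
    linarith
  have hp0 : ∀ j, 0 < p j := fun j => by rw [hp]; exact div_pos (hv0 j) hV
  have hp1 : ∑ j, p j = 1 := by
    simp only [hp]
    rw [← Finset.sum_div, div_self hV.ne']
  have hq0 : ∀ i j, 0 ≤ q i j := fun i j => by
    rw [hq]; exact div_nonneg (mul_nonneg (hω0 i) (hLnn i j)) (hv0 j).le
  have hq1 : ∀ j, ∑ i, q i j = 1 := by
    intro j
    simp only [hq]
    rw [← Finset.sum_div, ← hv, div_self (hv0 j).ne']
  have hqz : ∀ i j, q i j = 0 → Lmat i j = 0 := by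
    intro i j h0
    by_contra hne
    have hpos : 0 < Lmat i j := lt_of_le_of_ne (hLnn i j) (Ne.symm hne)
    rw [hq] at h0
    exact (div_pos (mul_pos (hω1 i j hpos) hpos) (hv0 j)).ne' h0
  have hPfun : P = fun w => (1 / (n : ℝ)) * ∑ i, f i w := funext hP
  have hPd : HasFDerivAt P (InnerProductSpace.toDual ℝ _ (P' wstar)) wstar := by
    rw [hPfun, hP']
    have := (HasFDerivAt.fun_sum (u := Finset.univ)
      fun i _ => (hgrad i wstar).hasFDerivAt).const_mul (1 / (n : ℝ))
    simpa using this
  have hPs : P' wstar = 0 := by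
    have hlm : IsLocalMin P wstar := Filter.Eventually.of_forall hmin
    have := hlm.hasFDerivAt_eq_zero hPd
    simpa using this
  have hgap : ∀ x, ∑ j, (p j)⁻¹ * ∑ i, ((f' i x) j - (f' i wstar) j) ^ 2 /
      ((n : ℝ) ^ 2 * q i j) ≤ 2 * Lhat * (P x - P wstar) := by
    intro x
    have hterm : ∀ i j, (p j)⁻¹ * (((f' i x) j - (f' i wstar) j) ^ 2 / ((n : ℝ) ^ 2 * q i j))
        ≤ Lhat / n * (if 0 < Lmat i j then
          (2 * (f i x - f i wstar - ⟪f' i wstar, x - wstar⟫)) / ωc i else 0) := by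
      intro i j
      split_ifs with hpos
      · have hg := grad_gap (f i) (f' i) (hgrad i) (hconvex i) j (Lmat i j) hpos
          (hLsmooth i j) x wstar
        have ho := hω1 i j hpos
        have heq : (p j)⁻¹ * (((f' i x) j - (f' i wstar) j) ^ 2 / ((n : ℝ) ^ 2 * q i j))
            = Lhat / n * (((f' i x) j - (f' i wstar) j) ^ 2 / Lmat i j / ωc i) := by
          have hvj := (hv0 j).ne'
          rw [hp, hq, hLhat]
          field_simp
        rw [heq]
        gcongr
      · have hz : Lmat i j = 0 := le_antisymm (not_lt.1 hpos) (hLnn i j)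
        rw [hLzero i j hz x wstar]
        simp
    have hrow : ∀ i, ∑ j, (p j)⁻¹ * (((f' i x) j - (f' i wstar) j) ^ 2 / ((n : ℝ) ^ 2 * q i j))
        ≤ Lhat / n * (2 * (f i x - f i wstar - ⟪f' i wstar, x - wstar⟫)) := by
      intro i
      refine (Finset.sum_le_sum fun j _ => hterm i j).trans ?_
      rw [← Finset.mul_sum]
      refine mul_le_mul_of_nonneg_left ?_ (by positivity)
      rw [← Finset.sum_filter, Finset.sum_const, nsmul_eq_mul]
      have hcard : (((Finset.univ.filter fun j => 0 < Lmat i j).card : ℕ) : ℝ) = ωc i := by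
        rw [hωc, Set.ncard_eq_toFinset_card']
        simp
      rw [hcard]
      have hg0 := convex_first_order (f i) (hconvex i) _ wstar x (hgrad i wstar)
      rcases (hω0 i).eq_or_lt with h0 | h0
      · rw [← h0]; simp; linarith
      · rw [mul_div_cancel₀ _ h0.ne']
    have hswap : ∑ j, (p j)⁻¹ * ∑ i, ((f' i x) j - (f' i wstar) j) ^ 2 / ((n : ℝ) ^ 2 * q i j)
        = ∑ i, ∑ j, (p j)⁻¹ * (((f' i x) j - (f' i wstar) j) ^ 2 / ((n : ℝ) ^ 2 * q i j)) := by
      rw [Finset.sum_comm]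
      exact Finset.sum_congr rfl fun j _ => Finset.mul_sum _ _ _
    rw [hswap]
    refine (Finset.sum_le_sum fun i _ => hrow i).trans (le_of_eq ?_)
    have hin : ∑ i, ⟪f' i wstar, x - wstar⟫ = 0 := by
      rw [← sum_inner]
      have h0 := hPs
      rw [hP'] at h0
      have h1 : ∑ i, f' i wstar = 0 := by
        rcases smul_eq_zero.1 h0 with h2 | h2
        · exact absurd h2 (by positivity)
        · exact h2
      rw [h1, inner_zero_left]
    rw [← Finset.mul_sum, ← Finset.mul_sum, Finset.sum_sub_distrib, Finset.sum_sub_distrib, hin,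
      hP, hP]
    ring
  have hρ0 : 0 ≤ 1 - μ * h := by linarith
  have hβ0 : 0 ≤ β := by rw [hβ]; exact Finset.sum_nonneg fun t _ => pow_nonneg hρ0 _
  have hπ0 : ∀ s : Fin d × Fin n, 0 ≤ p s.1 * q s.2 s.1 :=
    fun s => mul_nonneg (hp0 _).le (hq0 _ _)
  have hπ1 : ∑ s : Fin d × Fin n, p s.1 * q s.2 s.1 = 1 := by
    rw [Fintype.sum_prod_type]
    simp only [← Finset.mul_sum, hq1, mul_one, hp1]
  -- the epoch operator
  have hepoch : ∀ w, avgOp (fun a : Fin m × (Fin m → Fin d × Fin n) =>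
      (1 - μ * h) ^ (m - ((a.1 : ℕ) + 1)) / β * ∏ t, (p (a.2 t).1 * q (a.2 t).2 (a.2 t).1))
      (fun a w => s2cdEpoch f' P' p q h m w ((a.1 : ℕ) + 1) a.2) (fun x => P x - P wstar) w
      ≤ (chat • fun x => P x - P wstar) w := by
    intro w
    obtain ⟨hs1, hs2⟩ := one_step hn f' P P' hP' μ hstrong wstar hPs p q hp0 hp1 hq0 hq1
      (fun i j h0 => hLzero i j (hqz i j h0)) Lhat hgap h hh0 w
    have hRw : μ / 2 * ‖w - wstar‖ ^ 2 ≤ P w - P wstar := by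
      have := hstrong wstar w
      rw [hPs, inner_zero_left] at this
      linarith
    have hb := epoch_bound (fun s : Fin d × Fin n => p s.1 * q s.2 s.1) hπ0 hπ1
      (s2cdInnerStep f' P' p q h w) (fun x => P x - P wstar) (fun y => ‖y - wstar‖ ^ 2) w
      μ h Lhat hμ hh0 hL0 hhL' hμh (fun y => sub_nonneg.2 (hmin y)) (fun y => by positivity)
      hRw hs1 hs2 m hm β hβ
    rw [← hchat] at hb
    rw [Pi.smul_apply, smul_eq_mul]
    refine le_trans (le_of_eq ?_) hb
    rw [avgOp_apply, Fintype.sum_prod_type, ← Fin.sum_univ_eq_sum_range (fun t =>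
      (1 - μ * h) ^ (m - (t + 1)) / β * (avgOp (fun s : Fin d × Fin n => p s.1 * q s.2 s.1)
        (s2cdInnerStep f' P' p q h w) ^ (t + 1)) (fun x => P x - P wstar) w)]
    refine Finset.sum_congr rfl fun T _ => ?_
    rw [← sum_foldl_trunc (fun s : Fin d × Fin n => p s.1 * q s.2 s.1) hπ1
      (s2cdInnerStep f' P' p q h w) (fun x => P x - P wstar) m ((T : ℕ) + 1) T.2 w,
      Finset.mul_sum]
    refine Finset.sum_congr rfl fun σ _ => ?_
    simp only [s2cdEpoch, mul_assoc]
  have hrep : ∀ K : ℕ, ∑ ω : Fin K → Fin m × (Fin m → Fin d × Fin n),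
        s2cdWeight μ h β p q m ω * (P (s2cdIterate f' P' p q h m w0 K ω) - P wstar)
      = (avgOp (fun a : Fin m × (Fin m → Fin d × Fin n) =>
      (1 - μ * h) ^ (m - ((a.1 : ℕ) + 1)) / β * ∏ t, (p (a.2 t).1 * q (a.2 t).2 (a.2 t).1))
      (fun a w => s2cdEpoch f' P' p q h m w ((a.1 : ℕ) + 1) a.2) ^ K)
        (fun x => P x - P wstar) w0 := by
    intro K
    rw [← sum_foldl]
    rfl
  rw [hrep, hrep, pow_succ, Module.End.mul_apply]
  refine (avgOp_pow_mono _ (fun a => ?_) _ k _ _ hepoch w0).trans (le_of_eq ?_)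
  · exact mul_nonneg (div_nonneg (pow_nonneg hρ0 _) hβ0)
      (Finset.prod_nonneg fun t _ => hπ0 (a.2 t))
  · rw [map_smul, Pi.smul_apply, smul_eq_mul]
end
end

section
/- Let n ≥ 2 and 1 ≤ τ ≤ n be integers, let ξ_1, …, ξ_n ∈ ℝ^d, and let ξ̄ := (1/n) Σ_{i=1}^n ξ_i. If Ŝ is a subset of {1, …, n} of cardinality τ chosen uniformly at random among all subsets of cardinality τ, then E[ ‖ (1/τ) Σ_{i∈Ŝ} ξ_i − ξ̄ ‖² ] ≤ (1/(nτ)) · ((n − τ)/(n − 1)) · Σ_{i=1}^n ‖ξ_i‖². -/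
open scoped BigOperators

lemma vss_count1 (n t : ℕ) (i : Fin (n + 1)) :
    ((((Finset.univ : Finset (Fin (n + 1))).powersetCard (t + 1)).filter
      (fun S => i ∈ S)).card : ℕ) = n.choose t := by
  have h := Finset.card_filter_powersetCard_subset ({i} : Finset (Fin (n + 1))) Finset.univ (t + 1)
    (by simp) (by simp)
  simpa using h

lemma vss_count2 (n t : ℕ) (i j : Fin (n + 2)) (hij : i ≠ j) :
    ((((Finset.univ : Finset (Fin (n + 2))).powersetCard (t + 2)).filter
      (fun S => i ∈ S ∧ j ∈ S)).card : ℕ) = n.choose t := by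
  have hc : ({i, j} : Finset (Fin (n + 2))).card = 2 := Finset.card_pair hij
  have h := Finset.card_filter_powersetCard_subset ({i, j} : Finset (Fin (n + 2))) Finset.univ
    (t + 2) (by simp) (by rw [hc]; omega)
  rw [hc] at h
  simpa [Finset.insert_subset_iff] using h

lemma vss_count_one (n : ℕ) (i j : Fin n) (hij : i ≠ j) :
    ((((Finset.univ : Finset (Fin n)).powersetCard 1).filter
      (fun S => i ∈ S ∧ j ∈ S)).card : ℕ) = 0 := by
  rw [Finset.card_eq_zero, Finset.filter_eq_empty_iff]
  rintro S hS ⟨hi, hj⟩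
  rw [Finset.mem_powersetCard_univ, Finset.card_eq_one] at hS
  obtain ⟨a, rfl⟩ := hS
  simp at hi hj
  exact hij (hi.trans hj.symm)

lemma vss_sum {E : Type*} [NormedAddCommGroup E] [InnerProductSpace ℝ E] (n : ℕ)
    (P : Finset (Finset (Fin n))) (a b : ℝ) (x : Fin n → E) (hx : ∑ i, x i = 0)
    (ha : ∀ i, ((P.filter (fun S => i ∈ S)).card : ℝ) = a)
    (hb : ∀ i j, i ≠ j → ((P.filter (fun S => i ∈ S ∧ j ∈ S)).card : ℝ) = b) :
    ∑ S ∈ P, ‖∑ i ∈ S, x i‖ ^ 2 = (a - b) * ∑ i, ‖x i‖ ^ 2 := by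
  have h1 : ∀ S : Finset (Fin n), ‖∑ i ∈ S, x i‖ ^ 2 =
      ∑ i, ∑ j, if i ∈ S ∧ j ∈ S then inner ℝ (x i) (x j) else 0 := by
    intro S
    rw [← real_inner_self_eq_norm_sq, sum_inner]
    simp only [inner_sum]
    simp [ite_and, Finset.sum_ite_mem]
  have h2 : ∀ i j, ∑ S ∈ P, (if i ∈ S ∧ j ∈ S then inner ℝ (x i) (x j) else 0)
      = b * inner ℝ (x i) (x j) + if i = j then (a - b) * ‖x i‖ ^ 2 else 0 := by
    intro i j
    rw [← Finset.sum_filter, Finset.sum_const, nsmul_eq_mul]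
    by_cases h : i = j
    · subst h
      simp only [and_self, ha, if_true, real_inner_self_eq_norm_sq]
      ring
    · simp [hb i j h, h]
  simp only [h1]
  rw [Finset.sum_comm]
  have h3 : ∀ i, ∑ S ∈ P, ∑ j, (if i ∈ S ∧ j ∈ S then inner ℝ (x i) (x j) else 0)
      = (a - b) * ‖x i‖ ^ 2 := by
    intro i
    rw [Finset.sum_comm]
    simp only [h2, Finset.sum_add_distrib, ← Finset.mul_sum, ← inner_sum, hx]
    simp
  simp only [h3, Finset.mul_sum]

/-- **Variance of sampling a random fixed-size subset** (Lemma 4.7 of Konečný's thesis).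
Let `n ≥ 2`, `1 ≤ τ ≤ n`, `ξ_1, …, ξ_n ∈ ℝ^d` with mean `ξ̄`.  If `Ŝ` is a uniformly random
subset of `{1, …, n}` of cardinality `τ`, then
`E ‖(1/τ) ∑_{i∈Ŝ} ξ_i − ξ̄‖² ≤ (1/(nτ)) ((n−τ)/(n−1)) ∑_i ‖ξ_i‖²`. -/
theorem variance_of_subset_sampling
    (d n τ : ℕ) (hn : 2 ≤ n) (hτ1 : 1 ≤ τ) (hτn : τ ≤ n)
    (ξ : Fin n → EuclideanSpace ℝ (Fin d))
    (ξbar : EuclideanSpace ℝ (Fin d)) (hξbar : ξbar = (1 / (n : ℝ)) • ∑ i, ξ i) :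
    (1 / (((Finset.univ : Finset (Fin n)).powersetCard τ).card : ℝ)) *
        ∑ S ∈ (Finset.univ : Finset (Fin n)).powersetCard τ,
          ‖(1 / (τ : ℝ)) • (∑ i ∈ S, ξ i) - ξbar‖ ^ 2
      ≤ 1 / ((n : ℝ) * (τ : ℝ)) * (((n : ℝ) - (τ : ℝ)) / ((n : ℝ) - 1)) * ∑ i, ‖ξ i‖ ^ 2 := by
  have hn2 : (2 : ℝ) ≤ n := by exact_mod_cast hn
  have ht1 : (1 : ℝ) ≤ τ := by exact_mod_cast hτ1
  have htn : (τ : ℝ) ≤ n := by exact_mod_cast hτn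
  have hn0 : (n : ℝ) ≠ 0 := by positivity
  have ht0 : (τ : ℝ) ≠ 0 := by positivity
  have hn1 : (n : ℝ) - 1 ≠ 0 := by linarith
  have hsum : ∑ i, ξ i = (n : ℝ) • ξbar := by
    rw [hξbar, smul_smul, mul_one_div_cancel hn0, one_smul]
  have hx : ∑ i, (ξ i - ξbar) = 0 := by
    rw [Finset.sum_sub_distrib, hsum]
    simp [Nat.cast_smul_eq_nsmul]
  have hC : 0 < (n.choose τ : ℝ) := by exact_mod_cast Nat.choose_pos hτn
  have ha : ∀ i : Fin n, (((Finset.univ.powersetCard τ).filter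
      (fun S : Finset (Fin n) => i ∈ S)).card : ℝ) = τ / n * n.choose τ := by
    intro i
    obtain ⟨m, rfl⟩ : ∃ m, n = m + 1 := ⟨n - 1, by omega⟩
    obtain ⟨t, rfl⟩ : ∃ t, τ = t + 1 := ⟨τ - 1, by omega⟩
    rw [vss_count1]
    have h : ((m + 1 : ℕ) : ℝ) * m.choose t = (m + 1).choose (t + 1) * (t + 1 : ℕ) := by
      exact_mod_cast Nat.add_one_mul_choose_eq m t
    field_simp
    linarith
  have hb : ∀ i j : Fin n, i ≠ j → (((Finset.univ.powersetCard τ).filter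
      (fun S : Finset (Fin n) => i ∈ S ∧ j ∈ S)).card : ℝ)
        = τ * (τ - 1) / (n * (n - 1)) * n.choose τ := by
    intro i j hij
    obtain ⟨m, rfl⟩ : ∃ m, n = m + 2 := ⟨n - 2, by omega⟩
    rcases Nat.lt_or_ge τ 2 with h2 | h2
    · obtain rfl : τ = 1 := by omega
      rw [vss_count_one _ i j hij]
      simp
    obtain ⟨t, rfl⟩ : ∃ t, τ = t + 2 := ⟨τ - 2, by omega⟩
    rw [vss_count2 _ _ i j hij]
    have h : ((m + 1 + 1 : ℕ) : ℝ) * (m + 1).choose (t + 1)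
        = (m + 1 + 1).choose (t + 1 + 1) * (t + 1 + 1 : ℕ) := by
      exact_mod_cast Nat.add_one_mul_choose_eq (m + 1) (t + 1)
    have h' : ((m + 1 : ℕ) : ℝ) * m.choose t = (m + 1).choose (t + 1) * (t + 1 : ℕ) := by
      exact_mod_cast Nat.add_one_mul_choose_eq m t
    rw [div_mul_eq_mul_div, eq_div_iff (mul_ne_zero hn0 hn1)]
    push_cast at h h' ⊢
    linear_combination ((m : ℝ) + 2) * h' + ((t : ℝ) + 1) * h
  have key := vss_sum n _ _ _ (fun i => ξ i - ξbar) hx ha hb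
  have hS : ∀ S ∈ (Finset.univ : Finset (Fin n)).powersetCard τ,
      ‖(1 / (τ : ℝ)) • (∑ i ∈ S, ξ i) - ξbar‖ ^ 2
        = (1 / (τ : ℝ)) ^ 2 * ‖∑ i ∈ S, (ξ i - ξbar)‖ ^ 2 := by
    intro S hS
    rw [Finset.mem_powersetCard_univ] at hS
    have : (1 / (τ : ℝ)) • (∑ i ∈ S, ξ i) - ξbar = (1 / (τ : ℝ)) • ∑ i ∈ S, (ξ i - ξbar) := by
      rw [Finset.sum_sub_distrib, smul_sub, Finset.sum_const, hS, ← Nat.cast_smul_eq_nsmul ℝ,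
        smul_smul, one_div_mul_cancel ht0, one_smul]
    rw [this, norm_smul, mul_pow, Real.norm_eq_abs, sq_abs]
  have hle : ∑ i, ‖ξ i - ξbar‖ ^ 2 ≤ ∑ i, ‖ξ i‖ ^ 2 := by
    simp only [norm_sub_sq_real, Finset.sum_add_distrib, Finset.sum_sub_distrib,
      ← Finset.mul_sum, ← sum_inner, hsum, real_inner_smul_left, real_inner_self_eq_norm_sq]
    simp only [Finset.sum_const, Finset.card_univ, Fintype.card_fin, nsmul_eq_mul]
    nlinarith [mul_nonneg (by positivity : (0:ℝ) ≤ n) (sq_nonneg ‖ξbar‖)]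
  rw [Finset.sum_congr rfl hS, ← Finset.mul_sum, key, Finset.card_powersetCard, Finset.card_univ,
    Fintype.card_fin]
  have heq : ∀ V : ℝ, 1 / (n.choose τ : ℝ) * ((1 / (τ : ℝ)) ^ 2 * ((τ / n * n.choose τ
      - τ * (τ - 1) / (n * (n - 1)) * n.choose τ) * V))
      = 1 / ((n : ℝ) * (τ : ℝ)) * (((n : ℝ) - (τ : ℝ)) / ((n : ℝ) - 1)) * V := by
    intro V
    have := hC.ne'
    field_simp
    ring
  rw [heq]
  apply mul_le_mul_of_nonneg_left hle
  apply mul_nonneg (by positivity)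
  apply div_nonneg <;> linarith
end

section
/- Let y, w̃ ∈ ℝ^d with R(y) < ∞ and R(w̃) < ∞, let A be a uniformly random subset of {1, …, n} of cardinality b, and define G := ∇f(w̃) + (1/b) Σ_{i∈A} ( ∇f_i(y) − ∇f_i(w̃) ). Then E[G] = ∇f(y), and E[ ‖G − ∇f(y)‖² ] ≤ 4 L α(b) ( P(y) − P(w*) + P(w̃) − P(w*) ), where α(b) := (n − b)/(b(n − 1)). -/
open scoped RealInnerProductSpace BigOperators

section helpers

variable {E : Type*} [NormedAddCommGroup E] [InnerProductSpace ℝ E]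

lemma mb_count_one (n b : ℕ) (hb : 1 ≤ b) (i : Fin n) :
    (n : ℝ) * ((((Finset.univ : Finset (Fin n)).powersetCard b).filter (fun A => i ∈ A)).card : ℝ)
      = b * (((Finset.univ : Finset (Fin n)).powersetCard b).card : ℝ) := by
  have h := Finset.card_filter_powersetCard_subset {i} (Finset.univ : Finset (Fin n)) b
    (by simp) (by simpa using hb)
  simp only [Finset.singleton_subset_iff] at h
  rw [h, Finset.card_powersetCard]
  simp only [Finset.card_univ, Fintype.card_fin, Finset.card_singleton]
  have hn : 1 ≤ n := by have := i.pos; omega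
  obtain ⟨m, rfl⟩ : ∃ m, n = m + 1 := ⟨n - 1, by omega⟩
  obtain ⟨k, rfl⟩ : ∃ k, b = k + 1 := ⟨b - 1, by omega⟩
  have := Nat.add_one_mul_choose_eq m k
  simp only [Nat.add_sub_cancel]
  have h2 : (((m + 1) * m.choose k : ℕ) : ℝ) = (((m + 1).choose (k + 1) * (k + 1) : ℕ) : ℝ) := by
    exact_mod_cast this
  push_cast at h2 ⊢
  linarith

lemma mb_count_two (n b : ℕ) (hb : 1 ≤ b) (i j : Fin n) (hij : i ≠ j) :
    (n : ℝ) * ((n : ℝ) - 1) *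
      ((((Finset.univ : Finset (Fin n)).powersetCard b).filter (fun A => i ∈ A ∧ j ∈ A)).card : ℝ)
      = b * ((b : ℝ) - 1) * (((Finset.univ : Finset (Fin n)).powersetCard b).card : ℝ) := by
  have hc : ({i, j} : Finset (Fin n)).card = 2 := Finset.card_pair hij
  have hn : 2 ≤ n := by
    have := Finset.card_le_univ ({i, j} : Finset (Fin n))
    rw [hc] at this; simpa using this
  by_cases h1 : b = 1
  · subst h1
    have : ((Finset.univ : Finset (Fin n)).powersetCard 1).filter (fun A => i ∈ A ∧ j ∈ A) = ∅ := by
      ext A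
      simp only [Finset.mem_filter, Finset.mem_powersetCard_univ, Finset.notMem_empty, iff_false]
      rintro ⟨hA, hi, hj⟩
      exact hij (Finset.card_le_one.1 hA.le i hi j hj)
    rw [this]; simp
  · have h := Finset.card_filter_powersetCard_subset {i, j} (Finset.univ : Finset (Fin n)) b
      (by simp) (by rw [hc]; omega)
    simp only [Finset.insert_subset_iff, Finset.singleton_subset_iff] at h
    rw [h, Finset.card_powersetCard, hc]
    simp only [Finset.card_univ, Fintype.card_fin]
    obtain ⟨m, rfl⟩ : ∃ m, n = m + 2 := ⟨n - 2, by omega⟩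
    obtain ⟨k, rfl⟩ : ∃ k, b = k + 2 := ⟨b - 2, by omega⟩
    have e1 := Nat.add_one_mul_choose_eq m k
    have e2 := Nat.add_one_mul_choose_eq (m + 1) (k + 1)
    simp only [Nat.add_sub_cancel]
    have h1 : (((m + 1) * m.choose k : ℕ) : ℝ) = (((m + 1).choose (k + 1) * (k + 1) : ℕ) : ℝ) := by
      exact_mod_cast e1
    have h2 : (((m + 1 + 1) * (m + 1).choose (k + 1) : ℕ) : ℝ)
        = (((m + 1 + 1).choose (k + 1 + 1) * (k + 1 + 1) : ℕ) : ℝ) := by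
      exact_mod_cast e2
    have e3 : (m + 2).choose (k + 2) = (m + 1 + 1).choose (k + 1 + 1) := rfl
    rw [e3]
    push_cast at h1 h2 ⊢
    linear_combination ((m : ℝ) + 2) * h1 + ((k : ℝ) + 1) * h2

lemma mb_sum_one (n b : ℕ) (hb : 1 ≤ b) (u : Fin n → E) :
    (n : ℝ) • ∑ A ∈ (Finset.univ : Finset (Fin n)).powersetCard b, ∑ i ∈ A, u i
      = ((b : ℝ) * (((Finset.univ : Finset (Fin n)).powersetCard b).card : ℝ)) • ∑ i, u i := by
  have h : ∀ A : Finset (Fin n), ∑ i ∈ A, u i = ∑ i, if i ∈ A then u i else 0 := by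
    intro A; simp
  simp_rw [h]
  rw [Finset.sum_comm, Finset.smul_sum, Finset.smul_sum]
  refine Finset.sum_congr rfl fun i _ => ?_
  rw [← Finset.sum_filter, Finset.sum_const, ← Nat.cast_smul_eq_nsmul ℝ, smul_smul,
    mb_count_one n b hb i]
  simp

lemma mb_sum_two (n b : ℕ) (hb : 1 ≤ b) (u : Fin n → E) (hu : ∑ i, u i = 0) :
    (n : ℝ) * ((n : ℝ) - 1) *
      ∑ A ∈ (Finset.univ : Finset (Fin n)).powersetCard b, ‖∑ i ∈ A, u i‖ ^ 2
      = (b : ℝ) * ((n : ℝ) - b) * (((Finset.univ : Finset (Fin n)).powersetCard b).card : ℝ)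
        * ∑ i, ‖u i‖ ^ 2 := by
  set C : ℝ := (((Finset.univ : Finset (Fin n)).powersetCard b).card : ℝ) with hC
  have h : ∀ A : Finset (Fin n), ‖∑ i ∈ A, u i‖ ^ 2
      = ∑ i, ∑ j, if i ∈ A ∧ j ∈ A then (inner ℝ (u i) (u j) : ℝ) else 0 := by
    intro A
    rw [← real_inner_self_eq_norm_sq, sum_inner]
    simp_rw [inner_sum, ite_and]
    rw [← Finset.sum_filter_add_sum_filter_not Finset.univ (fun i => i ∈ A)]
    rw [Finset.sum_congr rfl (g := fun i => ∑ j ∈ A, inner ℝ (u i) (u j))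
      (s₁ := Finset.univ.filter (fun i => i ∈ A)) (s₂ := Finset.univ.filter (fun i => i ∈ A))]
    · rw [Finset.sum_eq_zero (s := Finset.univ.filter (fun i => ¬ i ∈ A))]
      · simp
      · intro i hi
        simp only [Finset.mem_filter] at hi
        simp [hi.2]
    · intro i hi
      simp only [Finset.mem_filter] at hi
      simp [hi.2]
  simp_rw [h]
  rw [Finset.sum_comm]
  simp_rw [Finset.sum_comm (s := (Finset.univ : Finset (Fin n)).powersetCard b)]
  have key : ∀ i j : Fin n, (n : ℝ) * ((n : ℝ) - 1) *
      (∑ A ∈ (Finset.univ : Finset (Fin n)).powersetCard b,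
        if i ∈ A ∧ j ∈ A then (inner ℝ (u i) (u j) : ℝ) else 0)
      = b * ((b : ℝ) - 1) * C * inner ℝ (u i) (u j)
        + if i = j then b * ((n : ℝ) - b) * C * ‖u i‖ ^ 2 else 0 := by
    intro i j
    rw [← Finset.sum_filter, Finset.sum_const, nsmul_eq_mul]
    by_cases hij : i = j
    · subst hij
      have := mb_count_one n b hb i
      rw [← hC] at this
      simp only [and_self, if_true, real_inner_self_eq_norm_sq]
      linear_combination ((n : ℝ) - 1) * ‖u i‖ ^ 2 * this
    · have := mb_count_two n b hb i j hij
      rw [← hC] at this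
      simp only [hij, if_false]
      linear_combination (inner ℝ (u i) (u j) : ℝ) * this
  simp_rw [Finset.mul_sum (s := (Finset.univ : Finset (Fin n)))]
  simp_rw [key, Finset.sum_add_distrib, ← Finset.mul_sum, ← inner_sum, hu]
  simp [Finset.mul_sum]

lemma mb_var_le (n : ℕ) (hn : 2 ≤ n) (v : Fin n → E) (m : E)
    (hm : m = (1 / (n : ℝ)) • ∑ i, v i) :
    ∑ i, ‖v i - m‖ ^ 2 ≤ ∑ i, ‖v i‖ ^ 2 := by
  have hn0 : (n : ℝ) ≠ 0 := by positivity
  have hs : ∑ i, v i = (n : ℝ) • m := by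
    rw [hm, smul_smul, mul_one_div_cancel hn0, one_smul]
  simp_rw [norm_sub_sq_real]
  rw [Finset.sum_add_distrib, Finset.sum_sub_distrib, ← Finset.mul_sum, ← sum_inner, hs,
    real_inner_smul_left, real_inner_self_eq_norm_sq]
  simp only [Finset.sum_const, Finset.card_univ, Fintype.card_fin, nsmul_eq_mul]
  have : 0 ≤ (n : ℝ) * ‖m‖ ^ 2 := by positivity
  linarith

variable [CompleteSpace E]

lemma mb_line (f : E → ℝ) (f' : E → E) (hg : ∀ x, HasGradientAt f (f' x) x) (x h : E) (t : ℝ) :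
    HasDerivAt (fun t : ℝ => f (x + t • h)) (inner ℝ (f' (x + t • h)) h) t := by
  have h1 : HasDerivAt (fun t : ℝ => x + t • h) h t := by
    simpa using ((hasDerivAt_id t).smul_const h).const_add x
  have := (hasGradientAt_iff_hasFDerivAt.1 (hg (x + t • h))).comp_hasDerivAt t h1
  rw [InnerProductSpace.toDual_apply_apply] at this
  exact this

lemma mb_descent (f : E → ℝ) (f' : E → E) (hg : ∀ x, HasGradientAt f (f' x) x) (L : ℝ)
    (hLip : ∀ x y, ‖f' x - f' y‖ ≤ L * ‖x - y‖) (x h : E) :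
    f (x + h) ≤ f x + inner ℝ (f' x) h + L / 2 * ‖h‖ ^ 2 := by
  let φ : ℝ → ℝ := fun t => f (x + t • h) - t * inner ℝ (f' x) h - L / 2 * ‖h‖ ^ 2 * t ^ 2
  have hd : ∀ t, HasDerivAt φ (inner ℝ (f' (x + t • h)) h - inner ℝ (f' x) h
      - L / 2 * ‖h‖ ^ 2 * (2 * t)) t := by
    intro t
    have h2 : HasDerivAt (fun t : ℝ => t * (inner ℝ (f' x) h : ℝ)) (inner ℝ (f' x) h) t := by
      simpa using (hasDerivAt_id t).mul_const (inner ℝ (f' x) h : ℝ)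
    have h3 : HasDerivAt (fun t : ℝ => L / 2 * ‖h‖ ^ 2 * t ^ 2) (L / 2 * ‖h‖ ^ 2 * (2 * t)) t := by
      simpa using (hasDerivAt_pow 2 t).const_mul (L / 2 * ‖h‖ ^ 2)
    exact ((mb_line f f' hg x h t).sub h2).sub h3
  have hanti : AntitoneOn φ (Set.Icc 0 1) := by
    apply antitoneOn_of_deriv_nonpos (convex_Icc 0 1)
    · exact fun t _ => (hd t).continuousAt.continuousWithinAt
    · exact fun t _ => (hd t).differentiableAt.differentiableWithinAt
    · intro t ht
      rw [interior_Icc] at ht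
      rw [(hd t).deriv, ← inner_sub_left]
      have h1 := real_inner_le_norm (f' (x + t • h) - f' x) h
      have h2 := hLip (x + t • h) x
      rw [add_sub_cancel_left, norm_smul, Real.norm_eq_abs, abs_of_pos ht.1] at h2
      have h3 := mul_le_mul_of_nonneg_right h2 (norm_nonneg h)
      nlinarith
  have := hanti (Set.left_mem_Icc.2 zero_le_one) (Set.right_mem_Icc.2 zero_le_one) zero_le_one
  simp only [φ, one_smul, zero_smul, add_zero] at this
  linarith

lemma mb_first_order (f : E → ℝ) (f' : E → E) (hg : ∀ x, HasGradientAt f (f' x) x)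
    (hc : ConvexOn ℝ Set.univ f) (x h : E) :
    f x + inner ℝ (f' x) h ≤ f (x + h) := by
  have hφ : ConvexOn ℝ Set.univ (fun t : ℝ => f (x + t • h)) := by
    refine ⟨convex_univ, fun s _ t _ a c ha hc' hac => ?_⟩
    have := hc.2 (Set.mem_univ (x + s • h)) (Set.mem_univ (x + t • h)) ha hc' hac
    convert this using 2
    have hx : x = (a + c) • x := by rw [hac, one_smul]
    nth_rewrite 1 [hx]
    simp only [smul_eq_mul]
    module
  have hd := mb_line f f' hg x h 0
  have := hφ.le_slope_of_hasDerivAt (Set.mem_univ 0) (Set.mem_univ 1) zero_lt_one hd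
  simp [slope_def_field] at this
  linarith

lemma mb_cocoercive (f : E → ℝ) (f' : E → E) (hg : ∀ x, HasGradientAt f (f' x) x)
    (hc : ConvexOn ℝ Set.univ f) (L : ℝ) (hL : 0 < L)
    (hLip : ∀ x y, ‖f' x - f' y‖ ≤ L * ‖x - y‖) (x z : E) :
    ‖f' z - f' x‖ ^ 2 ≤ 2 * L * (f z - f x - inner ℝ (f' x) (z - x)) := by
  set g := f' z - f' x with hgdef
  have h1 := mb_descent f f' hg L hLip z (-(1 / L) • g)
  have h2 := mb_first_order f f' hg hc x (z - x + (-(1 / L) • g))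
  have e : x + (z - x + (-(1 / L) • g)) = z + (-(1 / L) • g) := by abel
  rw [e, inner_add_right, inner_smul_right] at h2
  rw [inner_smul_right, norm_smul, mul_pow, Real.norm_eq_abs, sq_abs] at h1
  have h3 : (inner ℝ (f' z) g : ℝ) - inner ℝ (f' x) g = ‖g‖ ^ 2 := by
    rw [← inner_sub_left, ← hgdef, real_inner_self_eq_norm_sq]
  have h4 : f x + inner ℝ (f' x) (z - x) - f z ≤
      -(1 / L) * ‖g‖ ^ 2 + L / 2 * ((-(1 / L)) ^ 2 * ‖g‖ ^ 2) := by
    rw [← h3]; rw [← h3] at h1; linarith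
  have h5 : -(1 / L) * ‖g‖ ^ 2 + L / 2 * ((-(1 / L)) ^ 2 * ‖g‖ ^ 2) = - (‖g‖ ^ 2 / (2 * L)) := by
    field_simp; ring
  rw [h5] at h4
  have h6 : ‖g‖ ^ 2 / (2 * L) ≤ f z - f x - inner ℝ (f' x) (z - x) := by linarith
  rw [div_le_iff₀ (by positivity)] at h6
  linarith

end helpers

/-- **Unbiasedness and variance bound of the mini-batch stochastic gradient**
(Theorem 4.8 of Konečný's thesis).  Let `R : ℝ^d → ℝ ∪ {+∞}` be proper closed convex,
`f = (1/n) ∑ f_i` with convex `L`-smooth `f_i`, `P = f + R` attaining its minimum at `w*`.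
For `y, w̃` with `R(y), R(w̃) < ∞` and a uniformly random `b`-subset `A` of `{1, …, n}`,
`G = ∇f(w̃) + (1/b) ∑_{i∈A} (∇f_i(y) − ∇f_i(w̃))` satisfies `E[G] = ∇f(y)` and
`E ‖G − ∇f(y)‖² ≤ 4 L α(b) (P(y) − P(w*) + P(w̃) − P(w*))`, `α(b) = (n−b)/(b(n−1))`. -/
theorem minibatch_variance_bound
    (d n : ℕ) (hn : 2 ≤ n)
    (R : EuclideanSpace ℝ (Fin d) → EReal)
    (hRbot : ∀ x, R x ≠ ⊥)
    (hRproper : ∃ x, R x ≠ ⊤)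
    (hRconvex : ∀ (x y : EuclideanSpace ℝ (Fin d)) (s t : ℝ), 0 ≤ s → 0 ≤ t → s + t = 1 →
      R (s • x + t • y) ≤ (s : EReal) * R x + (t : EReal) * R y)
    (hRclosed : LowerSemicontinuous R)
    (f : Fin n → EuclideanSpace ℝ (Fin d) → ℝ)
    (f' : Fin n → EuclideanSpace ℝ (Fin d) → EuclideanSpace ℝ (Fin d))
    (hgrad : ∀ i x, HasGradientAt (f i) (f' i x) x)
    (hconvex : ∀ i, ConvexOn ℝ Set.univ (f i))
    (L : ℝ) (hL : 0 < L)
    (hLip : ∀ i (x y : EuclideanSpace ℝ (Fin d)), ‖f' i x - f' i y‖ ≤ L * ‖x - y‖)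
    (fbar : EuclideanSpace ℝ (Fin d) → ℝ)
    (hfbar : ∀ x, fbar x = (1 / (n : ℝ)) * ∑ i, f i x)
    (fbar' : EuclideanSpace ℝ (Fin d) → EuclideanSpace ℝ (Fin d))
    (hfbar' : ∀ x, fbar' x = (1 / (n : ℝ)) • ∑ i, f' i x)
    (P : EuclideanSpace ℝ (Fin d) → EReal)
    (hPdef : ∀ x, P x = (fbar x : EReal) + R x)
    (wstar : EuclideanSpace ℝ (Fin d)) (hmin : ∀ x, P wstar ≤ P x)
    (b : ℕ) (hb1 : 1 ≤ b) (hbn : b ≤ n)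
    (α : ℝ) (hα : α = ((n : ℝ) - (b : ℝ)) / ((b : ℝ) * ((n : ℝ) - 1)))
    (y wt : EuclideanSpace ℝ (Fin d)) (hyR : R y ≠ ⊤) (hwtR : R wt ≠ ⊤) :
    ((1 / (((Finset.univ : Finset (Fin n)).powersetCard b).card : ℝ)) •
        ∑ A ∈ (Finset.univ : Finset (Fin n)).powersetCard b,
          (fbar' wt + (1 / (b : ℝ)) • ∑ i ∈ A, (f' i y - f' i wt))
      = fbar' y)
    ∧ (1 / (((Finset.univ : Finset (Fin n)).powersetCard b).card : ℝ)) *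
        ∑ A ∈ (Finset.univ : Finset (Fin n)).powersetCard b,
          ‖fbar' wt + (1 / (b : ℝ)) • (∑ i ∈ A, (f' i y - f' i wt)) - fbar' y‖ ^ 2
      ≤ 4 * L * α *
          ((P y).toReal - (P wstar).toReal + (P wt).toReal - (P wstar).toReal) := by
  classical
  have hn0 : (0 : ℝ) < n := by positivity
  have hb0 : (0 : ℝ) < b := by exact_mod_cast hb1
  have hn1 : (0 : ℝ) < (n : ℝ) - 1 := by
    have : (2 : ℝ) ≤ n := by exact_mod_cast hn
    linarith
  have hbn' : (b : ℝ) ≤ n := by exact_mod_cast hbn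
  set C : ℝ := (((Finset.univ : Finset (Fin n)).powersetCard b).card : ℝ) with hC
  have hC0 : 0 < C := by
    rw [hC]
    have : ((Finset.univ : Finset (Fin n)).powersetCard b).Nonempty := by
      rw [Finset.powersetCard_nonempty]; simpa using hbn
    exact_mod_cast this.card_pos
  have hmean : fbar' y - fbar' wt = (1 / (n : ℝ)) • ∑ i, (f' i y - f' i wt) := by
    rw [hfbar', hfbar', Finset.sum_sub_distrib, smul_sub]
  -- finiteness
  have hfin : ∀ x, R x ≠ ⊤ → R x = ((R x).toReal : EReal) :=
    fun x hx => (EReal.coe_toReal hx (hRbot x)).symm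
  have hwR : R wstar ≠ ⊤ := by
    intro h
    have h1 := hmin y
    rw [hPdef, hPdef, h, hfin y hyR, EReal.coe_add_top, ← EReal.coe_add] at h1
    exact EReal.coe_ne_top _ (top_le_iff.1 h1)
  have hPr : ∀ x, R x ≠ ⊤ → (P x).toReal = fbar x + (R x).toReal := by
    intro x hx
    rw [hPdef]
    conv_lhs => rw [hfin x hx]
    rw [← EReal.coe_add, EReal.toReal_coe]
  -- optimality
  have hdesc : ∀ x h, fbar (x + h) ≤ fbar x + inner ℝ (fbar' x) h + L / 2 * ‖h‖ ^ 2 := by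
    intro x h
    have hs : ∑ i, f i (x + h) ≤ ∑ i, (f i x + inner ℝ (f' i x) h + L / 2 * ‖h‖ ^ 2) :=
      Finset.sum_le_sum fun i _ => mb_descent (f i) (f' i) (hgrad i) L (hLip i) x h
    simp only [Finset.sum_add_distrib, Finset.sum_const, Finset.card_univ, Fintype.card_fin,
      nsmul_eq_mul] at hs
    have := mul_le_mul_of_nonneg_left hs (by positivity : (0 : ℝ) ≤ 1 / n)
    rw [hfbar, hfbar, hfbar', real_inner_smul_left, sum_inner]
    have e : 1 / (n : ℝ) * (n * (L / 2 * ‖h‖ ^ 2)) = L / 2 * ‖h‖ ^ 2 := by field_simp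
    linarith
  have hopt : ∀ x, R x ≠ ⊤ →
      (R wstar).toReal - (R x).toReal ≤ inner ℝ (fbar' wstar) (x - wstar) := by
    intro x hx
    have hstep : ∀ t : ℝ, 0 < t → t ≤ 1 → (R wstar).toReal - (R x).toReal
        ≤ inner ℝ (fbar' wstar) (x - wstar) + t * (L / 2 * ‖x - wstar‖ ^ 2) := by
      intro t ht ht1
      have h1 := hRconvex wstar x (1 - t) t (by linarith) ht.le (by ring)
      have e : (1 - t) • wstar + t • x = wstar + t • (x - wstar) := by module
      rw [e] at h1
      have h2 := hmin (wstar + t • (x - wstar))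
      rw [hPdef, hPdef] at h2
      have h3 := h2.trans (add_le_add (le_refl _) h1)
      rw [hfin x hx, hfin wstar hwR] at h3
      have h4 : fbar wstar + (R wstar).toReal ≤ fbar (wstar + t • (x - wstar))
          + ((1 - t) * (R wstar).toReal + t * (R x).toReal) := by exact_mod_cast h3
      have h5 := hdesc wstar (t • (x - wstar))
      rw [inner_smul_right, norm_smul, mul_pow, Real.norm_eq_abs, sq_abs] at h5
      have h6 : t * ((R wstar).toReal - (R x).toReal)
        ≤ t * (inner ℝ (fbar' wstar) (x - wstar) + t * (L / 2 * ‖x - wstar‖ ^ 2)) := by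
        nlinarith
      exact le_of_mul_le_mul_left h6 ht
    refine le_of_forall_pos_le_add fun ε hε => ?_
    set K := L / 2 * ‖x - wstar‖ ^ 2 with hK
    have hK0 : 0 ≤ K := by positivity
    have h1 := hstep (min 1 (ε / (K + 1))) (by positivity) (min_le_left _ _)
    have h2 : min 1 (ε / (K + 1)) * K ≤ ε / (K + 1) * (K + 1) :=
      mul_le_mul (min_le_right _ _) (by linarith) hK0 (by positivity)
    rw [div_mul_cancel₀ _ (by positivity)] at h2
    linarith
  have hgb : ∀ x, R x ≠ ⊤ → ∑ i, ‖f' i x - f' i wstar‖ ^ 2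
      ≤ 2 * L * n * ((P x).toReal - (P wstar).toReal) := by
    intro x hx
    have hs : ∑ i, ‖f' i x - f' i wstar‖ ^ 2
        ≤ ∑ i, 2 * L * (f i x - f i wstar - inner ℝ (f' i wstar) (x - wstar)) :=
      Finset.sum_le_sum fun i _ =>
        mb_cocoercive (f i) (f' i) (hgrad i) (hconvex i) L hL (hLip i) wstar x
    rw [← Finset.mul_sum, Finset.sum_sub_distrib, Finset.sum_sub_distrib, ← sum_inner] at hs
    have e1 : ∀ z, ∑ i, f i z = n * fbar z := by
      intro z; rw [hfbar]; field_simp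
    have e2 : ∑ i, f' i wstar = (n : ℝ) • fbar' wstar := by
      rw [hfbar', smul_smul, mul_one_div_cancel hn0.ne', one_smul]
    rw [e1, e1, e2, real_inner_smul_left] at hs
    refine hs.trans ?_
    rw [hPr x hx, hPr wstar hwR]
    have := mul_le_mul_of_nonneg_left (hopt x hx) (by positivity : 0 ≤ 2 * L * n)
    linarith
  constructor
  · have h1 := mb_sum_one n b hb1 (fun i => f' i y - f' i wt)
    rw [← hC] at h1
    rw [Finset.sum_add_distrib, ← Finset.smul_sum, Finset.sum_const, ← Nat.cast_smul_eq_nsmul ℝ,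
      ← hC]
    have h2 : ∑ A ∈ (Finset.univ : Finset (Fin n)).powersetCard b, ∑ i ∈ A, (f' i y - f' i wt)
        = ((b : ℝ) * C) • (fbar' y - fbar' wt) := by
      rw [hmean, smul_comm, ← h1, smul_smul, one_div_mul_cancel hn0.ne', one_smul]
    rw [h2, smul_smul, smul_add, smul_smul, smul_smul]
    have e1 : 1 / C * C = 1 := one_div_mul_cancel hC0.ne'
    have e2 : 1 / C * (1 / (b : ℝ) * (b * C)) = 1 := by field_simp
    rw [e1, e2]; module
  · set m := fbar' y - fbar' wt with hm
    set u : Fin n → EuclideanSpace ℝ (Fin d) := fun i => f' i y - f' i wt - m with hu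
    have hu0 : ∑ i, u i = 0 := by
      simp only [hu]
      rw [Finset.sum_sub_distrib, Finset.sum_const, Finset.card_univ, Fintype.card_fin,
        ← Nat.cast_smul_eq_nsmul ℝ, hmean, smul_smul, mul_one_div_cancel hn0.ne', one_smul,
        sub_self]
    have hterm : ∀ A ∈ (Finset.univ : Finset (Fin n)).powersetCard b,
        ‖fbar' wt + (1 / (b : ℝ)) • (∑ i ∈ A, (f' i y - f' i wt)) - fbar' y‖ ^ 2
        = (1 / (b : ℝ)) ^ 2 * ‖∑ i ∈ A, u i‖ ^ 2 := by
      intro A hA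
      have hAc : A.card = b := (Finset.mem_powersetCard.1 hA).2
      have : fbar' wt + (1 / (b : ℝ)) • (∑ i ∈ A, (f' i y - f' i wt)) - fbar' y
          = (1 / (b : ℝ)) • ∑ i ∈ A, u i := by
        simp only [hu]
        rw [Finset.sum_sub_distrib (fun i => f' i y - f' i wt) (fun _ => m),
          Finset.sum_const, hAc, ← Nat.cast_smul_eq_nsmul ℝ, smul_sub,
          smul_smul _ (b : ℝ), one_div_mul_cancel hb0.ne', one_smul, hm]
        abel
      rw [this, norm_smul, mul_pow, Real.norm_eq_abs, sq_abs]
    rw [Finset.sum_congr rfl hterm, ← Finset.mul_sum]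
    have h2 := mb_sum_two n b hb1 u hu0
    rw [← hC] at h2
    set S := ∑ A ∈ (Finset.univ : Finset (Fin n)).powersetCard b, ‖∑ i ∈ A, u i‖ ^ 2 with hS
    have h3 : 1 / C * ((1 / (b : ℝ)) ^ 2 * S) = α * (1 / n) * ∑ i, ‖u i‖ ^ 2 := by
      rw [hα]
      have hS' : S = (b : ℝ) * ((n : ℝ) - b) * C * (∑ i, ‖u i‖ ^ 2) / (n * ((n : ℝ) - 1)) := by
        rw [eq_div_iff (by positivity)]; linarith
      rw [hS']
      field_simp
    rw [h3]
    have hα0 : 0 ≤ α := by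
      rw [hα]; exact div_nonneg (by linarith) (by positivity)
    have h4 : ∑ i, ‖u i‖ ^ 2 ≤ ∑ i, ‖f' i y - f' i wt‖ ^ 2 :=
      mb_var_le n hn (fun i => f' i y - f' i wt) m hmean
    have h5 : ∑ i, ‖f' i y - f' i wt‖ ^ 2
        ≤ ∑ i, (2 * ‖f' i y - f' i wstar‖ ^ 2 + 2 * ‖f' i wt - f' i wstar‖ ^ 2) := by
      refine Finset.sum_le_sum fun i _ => ?_
      have e : f' i y - f' i wt = (f' i y - f' i wstar) - (f' i wt - f' i wstar) := by abel
      rw [e]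
      have := parallelogram_law_with_norm ℝ (f' i y - f' i wstar) (f' i wt - f' i wstar)
      nlinarith [mul_self_nonneg ‖f' i y - f' i wstar + (f' i wt - f' i wstar)‖]
    rw [Finset.sum_add_distrib, ← Finset.mul_sum, ← Finset.mul_sum] at h5
    have h6 := hgb y hyR
    have h7 := hgb wt hwtR
    have h8 : ∑ i, ‖u i‖ ^ 2 ≤ n * (4 * L *
        ((P y).toReal - (P wstar).toReal + (P wt).toReal - (P wstar).toReal)) := by linarith
    have h9 := mul_le_mul_of_nonneg_left h8 (by positivity : 0 ≤ α * (1 / (n : ℝ)))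
    refine h9.trans (le_of_eq ?_)
    field_simp
end

section
/- If 0 < h ≤ 1/L, 4hLα(b) < 1, and c := 1 / ( m h μ (1 − 4hLα(b)) ) + 4hLα(b)(m + 1) / ( m (1 − 4hLα(b)) ) < 1, then for all k ≥ 0 the mS2GD iterates satisfy E[ P(w^k) − P(w*) ] ≤ c^k ( P(w^0) − P(w*) ). -/
open scoped RealInnerProductSpace BigOperators

noncomputable section

/-- One stochastic inner step of the mS2GD algorithm:
`y ↦ prox_{hR}(y − h (g + (1/b) ∑_{i∈A} (∇f_i(y) − ∇f_i(w))))`, where `g = ∇f(w)`. -/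
def ms2gdInnerStep {d n : ℕ}
    (f' : Fin n → EuclideanSpace ℝ (Fin d) → EuclideanSpace ℝ (Fin d))
    (prox : EuclideanSpace ℝ (Fin d) → EuclideanSpace ℝ (Fin d)) (h : ℝ) (b : ℕ)
    (w g : EuclideanSpace ℝ (Fin d)) (A : Finset (Fin n))
    (y : EuclideanSpace ℝ (Fin d)) : EuclideanSpace ℝ (Fin d) :=
  prox (y - h • (g + (1 / (b : ℝ)) • ∑ i ∈ A, (f' i y - f' i w)))

/-- The result of one mS2GD epoch of length `T ≤ m` started at `w`, where the `t`-th inner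
step uses the sampled mini-batch `σ t`. -/
def ms2gdEpoch {d n : ℕ}
    (f' : Fin n → EuclideanSpace ℝ (Fin d) → EuclideanSpace ℝ (Fin d))
    (fbar' : EuclideanSpace ℝ (Fin d) → EuclideanSpace ℝ (Fin d))
    (prox : EuclideanSpace ℝ (Fin d) → EuclideanSpace ℝ (Fin d)) (h : ℝ) (b m : ℕ)
    (w : EuclideanSpace ℝ (Fin d)) (T : ℕ) (σ : Fin m → Finset (Fin n)) :
    EuclideanSpace ℝ (Fin d) :=
  (List.finRange m).foldl
    (fun y (t : Fin m) =>
      if (t : ℕ) < T then ms2gdInnerStep f' prox h b w (fbar' w) (σ t) y else y) w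

/-- The iterate `w^k` produced by `k` epochs of mS2GD started from `w0`, given the random
seed `ω`: in epoch `j`, the epoch length is `(ω j).1 + 1` (uniform on `{1, …, m}`) and the
sampled mini-batches are given by `(ω j).2`. -/
def ms2gdIterate {d n : ℕ}
    (f' : Fin n → EuclideanSpace ℝ (Fin d) → EuclideanSpace ℝ (Fin d))
    (fbar' : EuclideanSpace ℝ (Fin d) → EuclideanSpace ℝ (Fin d))
    (prox : EuclideanSpace ℝ (Fin d) → EuclideanSpace ℝ (Fin d)) (h : ℝ) (b m : ℕ)
    (w0 : EuclideanSpace ℝ (Fin d)) (k : ℕ)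
    (ω : Fin k → Fin m × (Fin m → Finset (Fin n))) : EuclideanSpace ℝ (Fin d) :=
  (List.finRange k).foldl
    (fun w j => ms2gdEpoch f' fbar' prox h b m w (((ω j).1 : ℕ) + 1) (ω j).2) w0

/-- The probability of the random seed `ω` of `k` epochs of mS2GD: the epoch length is
uniform on `{1, …, m}` and each of the `m` mini-batches of an epoch is a uniformly random
`b`-element subset of `{1, …, n}`. -/
def ms2gdWeight (n b m : ℕ) {k : ℕ} (ω : Fin k → Fin m × (Fin m → Finset (Fin n))) : ℝ :=
  ∏ j, ((1 / (m : ℝ)) *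
    ∏ t, (if ((ω j).2 t).card = b then 1 / (n.choose b : ℝ) else 0))

/-- Probability of a mini-batch. -/
def ms2gdP (n b : ℕ) (A : Finset (Fin n)) : ℝ :=
  if A.card = b then 1 / (n.choose b : ℝ) else 0

lemma ms2gdP_nonneg (n b : ℕ) (A : Finset (Fin n)) : 0 ≤ ms2gdP n b A := by
  unfold ms2gdP; split_ifs <;> positivity

lemma ms2gdP_subset (n b : ℕ) (S : Finset (Fin n)) (hS : S.card ≤ b) :
    ∑ A, ms2gdP n b A * (if S ⊆ A then 1 else 0)
      = ((n - S.card).choose (b - S.card) : ℝ) / (n.choose b : ℝ) := by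
  have h1 := Finset.card_filter_powersetCard_subset S Finset.univ b (Finset.subset_univ S) hS
  have h2 : ∀ A : Finset (Fin n), ms2gdP n b A * (if S ⊆ A then 1 else 0)
      = if A ∈ (Finset.univ.powersetCard b).filter (S ⊆ ·) then 1 / (n.choose b : ℝ) else 0 := by
    intro A
    simp only [ms2gdP, Finset.mem_filter, Finset.mem_powersetCard_univ]
    by_cases hA : A.card = b <;> by_cases hs : S ⊆ A <;> simp [hA, hs]
  rw [Finset.sum_congr rfl (fun A _ => h2 A), Finset.sum_ite_mem, Finset.univ_inter,
    Finset.sum_const, h1]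
  simp
  ring

lemma ms2gdP_sum (n b : ℕ) (hbn : b ≤ n) : ∑ A, ms2gdP n b A = 1 := by
  have := ms2gdP_subset n b ∅ (by simp)
  simp at this
  rw [this]
  have : (n.choose b : ℝ) ≠ 0 := by exact_mod_cast (Nat.choose_pos hbn).ne'
  field_simp

lemma ms2gdP_one (n b : ℕ) (hb : 1 ≤ b) (hbn : b ≤ n) (i : Fin n) :
    ∑ A, ms2gdP n b A * (if i ∈ A then 1 else 0) = (b : ℝ) / n := by
  have := ms2gdP_subset n b {i} (by simpa using hb)
  simp only [Finset.singleton_subset_iff, Finset.card_singleton] at this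
  rw [this]
  obtain ⟨b, rfl⟩ : ∃ c, b = c + 1 := ⟨b - 1, by omega⟩
  obtain ⟨n, rfl⟩ : ∃ c, n = c + 1 := ⟨n - 1, by omega⟩
  have hc : ((n+1).choose (b+1) : ℝ) ≠ 0 := by exact_mod_cast (Nat.choose_pos hbn).ne'
  have h3 : ((n + 1 : ℕ) : ℝ) * n.choose b = (n+1).choose (b+1) * (b + 1 : ℕ) := by
    exact_mod_cast Nat.add_one_mul_choose_eq n b
  have : ((n + 1 : ℕ) : ℝ) ≠ 0 := by positivity
  simp only [Nat.add_sub_cancel]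
  rw [div_eq_div_iff hc this]
  linarith

lemma ms2gdP_two (n b : ℕ) (hn : 2 ≤ n) (hb : 1 ≤ b) (hbn : b ≤ n) (i j : Fin n) (hij : i ≠ j) :
    ∑ A, ms2gdP n b A * (if i ∈ A ∧ j ∈ A then 1 else 0)
      = (b : ℝ) * (b - 1) / (n * (n - 1)) := by
  by_cases hb2 : 2 ≤ b
  · have := ms2gdP_subset n b {i, j} (by rw [Finset.card_pair hij]; exact hb2)
    simp only [Finset.card_pair hij, Finset.insert_subset_iff, Finset.singleton_subset_iff] at this
    rw [this]
    obtain ⟨b, rfl⟩ : ∃ c, b = c + 2 := ⟨b - 2, by omega⟩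
    obtain ⟨n, rfl⟩ : ∃ c, n = c + 2 := ⟨n - 2, by omega⟩
    have hc : ((n+2).choose (b+2) : ℝ) ≠ 0 := by exact_mod_cast (Nat.choose_pos hbn).ne'
    have h3 : ((n + 1 : ℕ) : ℝ) * n.choose b = (n+1).choose (b+1) * (b + 1 : ℕ) := by
      exact_mod_cast Nat.add_one_mul_choose_eq n b
    have h4 : ((n + 2 : ℕ) : ℝ) * (n+1).choose (b+1) = (n+2).choose (b+2) * (b + 2 : ℕ) := by
      exact_mod_cast Nat.add_one_mul_choose_eq (n+1) (b+1)
    simp only [Nat.add_sub_cancel]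
    push_cast at *
    have : ((n:ℝ) + 2) * (n + 2 - 1) ≠ 0 := by
      have : (0:ℝ) ≤ n := by positivity
      apply ne_of_gt; apply mul_pos <;> linarith
    rw [div_eq_div_iff hc this]
    linear_combination ((n:ℝ)+2) * h3 + ((b:ℝ)+1) * h4
  · have : b = 1 := by omega
    subst this
    simp only [Nat.cast_one, sub_self, mul_zero, zero_div]
    apply Finset.sum_eq_zero
    intro A _
    by_cases hA : A.card = 1
    · obtain ⟨a, rfl⟩ := Finset.card_eq_one.mp hA
      have : ¬ (i ∈ ({a} : Finset (Fin n)) ∧ j ∈ ({a} : Finset (Fin n))) := by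
        simp only [Finset.mem_singleton]; rintro ⟨rfl, rfl⟩; exact hij rfl
      rw [if_neg this, mul_zero]
    · simp [ms2gdP, hA]

section
variable {E : Type*} [NormedAddCommGroup E] [InnerProductSpace ℝ E]

lemma ms2gdP_mean (n b : ℕ) (hb : 1 ≤ b) (hbn : b ≤ n) (c : Fin n → E) (hc : ∑ i, c i = 0) :
    ∑ A, ms2gdP n b A • ∑ i ∈ A, c i = 0 := by
  have h1 : ∀ A : Finset (Fin n), ms2gdP n b A • ∑ i ∈ A, c i
      = ∑ i, (ms2gdP n b A * (if i ∈ A then 1 else 0)) • c i := by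
    intro A
    rw [← Finset.univ_inter A, ← Finset.sum_ite_mem, Finset.smul_sum, Finset.univ_inter]
    refine Finset.sum_congr rfl fun i _ => ?_
    split_ifs <;> simp
  simp_rw [h1]
  rw [Finset.sum_comm]
  simp_rw [← Finset.sum_smul, ms2gdP_one n b hb hbn, ← Finset.smul_sum, hc, smul_zero]

lemma ms2gdP_var (n b : ℕ) (hn : 2 ≤ n) (hb : 1 ≤ b) (hbn : b ≤ n) (c : Fin n → E)
    (hc : ∑ i, c i = 0) :
    ∑ A, ms2gdP n b A * ‖∑ i ∈ A, c i‖ ^ 2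
      = (b : ℝ) * (n - b) / (n * (n - 1)) * ∑ i, ‖c i‖ ^ 2 := by
  have h1 : ∀ A : Finset (Fin n), ms2gdP n b A * ‖∑ i ∈ A, c i‖ ^ 2
      = ∑ i, ∑ j, (ms2gdP n b A * (if i ∈ A ∧ j ∈ A then 1 else 0)) * ⟪c i, c j⟫ := by
    intro A
    rw [← real_inner_self_eq_norm_sq]
    rw [← Finset.univ_inter A, ← Finset.sum_ite_mem, sum_inner, Finset.univ_inter, Finset.mul_sum]
    refine Finset.sum_congr rfl fun i _ => ?_
    rw [inner_sum, Finset.mul_sum]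
    refine Finset.sum_congr rfl fun j _ => ?_
    by_cases hi : i ∈ A <;> by_cases hj : j ∈ A <;> simp [hi, hj]
  simp_rw [h1]
  rw [Finset.sum_comm]
  have h2 : ∀ i, ∑ A, ∑ j, (ms2gdP n b A * (if i ∈ A ∧ j ∈ A then 1 else 0)) * ⟪c i, c j⟫
      = (b : ℝ) * (n - b) / (n * (n - 1)) * ‖c i‖ ^ 2 := by
    intro i
    rw [Finset.sum_comm]
    simp_rw [← Finset.sum_mul]
    have h3 : ∀ j, (∑ A, ms2gdP n b A * (if i ∈ A ∧ j ∈ A then 1 else 0)) * ⟪c i, c j⟫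
       = (b : ℝ) * (b - 1) / (n * (n - 1)) * ⟪c i, c j⟫
         + if i = j then (b : ℝ) * (n - b) / (n * (n - 1)) * ⟪c i, c j⟫ else 0 := by
      intro j
      by_cases hij : i = j
      · subst hij
        simp only [and_self, if_true]
        rw [ms2gdP_one n b hb hbn, ← add_mul]
        congr 1
        have : (2:ℝ) ≤ n := by exact_mod_cast hn
        have h5 : (n:ℝ) ≠ 0 := by linarith
        have h6 : (n:ℝ) - 1 ≠ 0 := by linarith
        field_simp
        ring
      · rw [ms2gdP_two n b hn hb hbn i j hij, if_neg hij, add_zero]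
    simp_rw [h3]
    rw [Finset.sum_add_distrib, ← Finset.mul_sum, ← inner_sum, hc, inner_zero_right]
    simp
  simp_rw [h2, ← Finset.mul_sum]

lemma ms2gd_limit (a b C : ℝ) (H : ∀ s : ℝ, 0 < s → s ≤ 1 → a ≤ b + s * C) : a ≤ b := by
  by_contra hlt
  push Not at hlt
  have h1 := H 1 one_pos le_rfl
  have hC : 0 < C := by linarith
  have h2 := H (min 1 ((a - b) / (2 * C))) (lt_min one_pos (by apply div_pos <;> linarith)) (min_le_left _ _)
  have h3 : min 1 ((a - b) / (2 * C)) * C ≤ (a - b) / (2 * C) * C :=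
    mul_le_mul_of_nonneg_right (min_le_right _ _) hC.le
  have h4 : (a - b) / (2 * C) * C = (a - b) / 2 := by field_simp
  linarith

variable [CompleteSpace E]

lemma ms2gd_descent (f : E → ℝ) (f' : E → E) (hg : ∀ x, HasGradientAt f (f' x) x) (L : ℝ)
    (hLip : ∀ x y, ‖f' x - f' y‖ ≤ L * ‖x - y‖) (x y : E) :
    f y ≤ f x + ⟪f' x, y - x⟫ + L / 2 * ‖y - x‖ ^ 2 := by
  set v := y - x with hv
  let g : ℝ → ℝ := fun t => f (x + t • v) - t * ⟪f' x, v⟫ - L / 2 * t ^ 2 * ‖v‖ ^ 2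
  have hd : ∀ t, HasDerivAt g (⟪f' (x + t • v), v⟫ - ⟪f' x, v⟫ - L * t * ‖v‖ ^ 2) t := by
    intro t
    have h1 : HasDerivAt (fun t : ℝ => x + t • v) v t := by
      simpa using ((hasDerivAt_id t).smul_const v).const_add x
    have h2 := (hg (x + t • v)).hasFDerivAt.comp_hasDerivAt t h1
    have h3 := (hasDerivAt_id t).mul_const ⟪f' x, v⟫
    have h4 : HasDerivAt (fun t : ℝ => L / 2 * t ^ 2 * ‖v‖ ^ 2) (L * t * ‖v‖ ^ 2) t := by
      have h5 := ((hasDerivAt_pow 2 t).const_mul (L / 2)).mul_const (‖v‖ ^ 2)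
      exact h5.congr_deriv (by push_cast; ring)
    have h6 : HasDerivAt (fun t : ℝ => t * ⟪f' x, v⟫) ⟪f' x, v⟫ t := by
      simpa using h3
    have h7 : HasDerivAt (fun t : ℝ => f (x + t • v)) ⟪f' (x + t • v), v⟫ t := by
      exact h2.congr_deriv (by simp)
    exact (h7.sub h6).sub h4
  have hanti : AntitoneOn g (Set.Ici 0) := by
    apply antitoneOn_of_deriv_nonpos (convex_Ici 0)
    · exact fun t _ => (hd t).continuousAt.continuousWithinAt
    · exact fun t _ => (hd t).differentiableAt.differentiableWithinAt
    · intro t ht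
      rw [interior_Ici] at ht
      rw [(hd t).deriv, ← inner_sub_left]
      have h5 := real_inner_le_norm (f' (x + t • v) - f' x) v
      have h6 := hLip (x + t • v) x
      have h7 : ‖x + t • v - x‖ = t * ‖v‖ := by
        rw [add_sub_cancel_left, norm_smul, Real.norm_of_nonneg (le_of_lt ht)]
      rw [h7] at h6
      have := mul_le_mul_of_nonneg_right h6 (norm_nonneg v)
      nlinarith
  have := hanti (Set.mem_Ici.2 le_rfl) (Set.mem_Ici.2 zero_le_one) zero_le_one
  simp only [g] at this
  simp at this
  have hxy : x + v = y := by rw [hv]; abel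
  rw [hxy] at this
  linarith

lemma ms2gd_descent' (f : E → ℝ) (f' : E → E) (hg : ∀ x, HasGradientAt f (f' x) x) (L : ℝ)
    (hLip : ∀ x y, ‖f' x - f' y‖ ≤ L * ‖x - y‖) (x y : E) :
    f x + ⟪f' x, y - x⟫ - L / 2 * ‖y - x‖ ^ 2 ≤ f y := by
  have := ms2gd_descent (fun x => - f x) (fun x => - f' x)
    (fun x => by
      have := (hg x).hasFDerivAt.neg
      rw [hasGradientAt_iff_hasFDerivAt]
      rw [map_neg]
      exact this) L
    (fun x y => by
      have := hLip x y
      rwa [neg_sub_neg, norm_sub_rev]) x y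
  simp only [inner_neg_left] at this
  linarith

lemma ms2gd_firstorder (f : E → ℝ) (f' : E → E) (hg : ∀ x, HasGradientAt f (f' x) x) (L : ℝ)
    (hLip : ∀ x y, ‖f' x - f' y‖ ≤ L * ‖x - y‖) (hcv : ConvexOn ℝ Set.univ f) (x y : E) :
    f x + ⟪f' x, y - x⟫ ≤ f y := by
  apply ms2gd_limit _ _ (L / 2 * ‖y - x‖ ^ 2)
  intro s hs hs1
  have h1 := ms2gd_descent' f f' hg L hLip x (x + s • (y - x))
  have h2 := hcv.2 (Set.mem_univ x) (Set.mem_univ y) (sub_nonneg.2 hs1) hs.le (by ring)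
  have h3 : (1 - s) • x + s • y = x + s • (y - x) := by
    rw [smul_sub, sub_smul, one_smul]; abel
  rw [h3] at h2
  rw [add_sub_cancel_left, inner_smul_right, norm_smul, Real.norm_of_nonneg hs.le] at h1
  simp only [smul_eq_mul] at h2
  have : s * (f x + ⟪f' x, y - x⟫) ≤ s * (f y + s * (L / 2 * ‖y - x‖ ^ 2)) := by nlinarith
  exact le_of_mul_le_mul_left this hs

lemma ms2gd_coco (f : E → ℝ) (f' : E → E) (hg : ∀ x, HasGradientAt f (f' x) x) (L : ℝ)
    (hL : 0 < L)
    (hLip : ∀ x y, ‖f' x - f' y‖ ≤ L * ‖x - y‖) (hcv : ConvexOn ℝ Set.univ f) (x y : E) :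
    ‖f' x - f' y‖ ^ 2 ≤ 2 * L * (f x - f y - ⟪f' y, x - y⟫) := by
  set u := f' x - f' y with hu
  have h1 := ms2gd_descent f f' hg L hLip x (x - (1 / L) • u)
  have h2 := ms2gd_firstorder f f' hg L hLip hcv y (x - (1 / L) • u)
  have h3 : x - (1 / L) • u - x = - ((1 / L) • u) := by abel
  have h4 : x - (1 / L) • u - y = (x - y) - (1 / L) • u := by abel
  rw [h3, norm_neg, inner_neg_right, inner_smul_right, norm_smul,
    Real.norm_of_nonneg (by positivity)] at h1
  rw [h4, inner_sub_right, inner_smul_right] at h2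
  have h5 : ⟪f' x, u⟫ - ⟪f' y, u⟫ = ‖u‖ ^ 2 := by
    rw [← inner_sub_left, ← hu, real_inner_self_eq_norm_sq]
  have h6 : L / 2 * (1 / L * ‖u‖) ^ 2 = 1 / L * ‖u‖ ^ 2 / 2 := by field_simp
  have h7 : 1 / L * ‖u‖ ^ 2 / 2 ≤ f x - f y - ⟪f' y, x - y⟫ := by
    rw [h6] at h1
    have : 1 / L * ⟪f' x, u⟫ - 1 / L * ⟪f' y, u⟫ = 1 / L * ‖u‖ ^ 2 := by rw [← h5]; ring
    linarith
  have h8 : ‖u‖ ^ 2 = 2 * L * (1 / L * ‖u‖ ^ 2 / 2) := by field_simp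
  rw [h8]
  exact mul_le_mul_of_nonneg_left h7 (by positivity)

lemma ms2gd_prox_ineq (D : Set E) (r : E → ℝ)
    (hconv : ∀ x ∈ D, ∀ y ∈ D, ∀ s : ℝ, 0 ≤ s → s ≤ 1 →
      (1 - s) • x + s • y ∈ D ∧ r ((1 - s) • x + s • y) ≤ (1 - s) * r x + s * r y)
    (h : ℝ) (hh0 : 0 < h) (z p : E) (hp : p ∈ D)
    (hprox : ∀ w ∈ D, 1 / 2 * ‖p - z‖ ^ 2 + h * r p ≤ 1 / 2 * ‖w - z‖ ^ 2 + h * r w)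
    (y : E) (hy : y ∈ D) :
    ⟪z - p, y - p⟫ ≤ h * (r y - r p) := by
  apply ms2gd_limit _ _ (1 / 2 * ‖y - p‖ ^ 2)
  intro s hs hs1
  obtain ⟨h1, h2⟩ := hconv p hp y hy s hs.le hs1
  have h3 := hprox _ h1
  have h4 : (1 - s) • p + s • y - z = (p - z) + s • (y - p) := by
    rw [smul_sub, sub_smul, one_smul]; abel
  rw [h4, norm_add_sq_real, inner_smul_right, norm_smul, Real.norm_of_nonneg hs.le] at h3
  have h5 : ⟪p - z, y - p⟫ = - ⟪z - p, y - p⟫ := by rw [← inner_neg_left, neg_sub]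
  rw [h5] at h3
  have h6 := mul_le_mul_of_nonneg_left h2 hh0.le
  have : s * ⟪z - p, y - p⟫ ≤ s * (h * (r y - r p) + s * (1 / 2 * ‖y - p‖ ^ 2)) := by nlinarith
  exact le_of_mul_le_mul_left this hs

lemma ms2gd_opt (D : Set E) (r : E → ℝ)
    (hconv : ∀ x ∈ D, ∀ y ∈ D, ∀ s : ℝ, 0 ≤ s → s ≤ 1 →
      (1 - s) • x + s • y ∈ D ∧ r ((1 - s) • x + s • y) ≤ (1 - s) * r x + s * r y)
    (f : E → ℝ) (f' : E → E) (L : ℝ)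
    (hdesc : ∀ x y, f y ≤ f x + ⟪f' x, y - x⟫ + L / 2 * ‖y - x‖ ^ 2)
    (p : E) (hp : p ∈ D) (hmin : ∀ x ∈ D, f p + r p ≤ f x + r x)
    (y : E) (hy : y ∈ D) :
    r p - r y ≤ ⟪f' p, y - p⟫ := by
  apply ms2gd_limit _ _ (L / 2 * ‖y - p‖ ^ 2)
  intro s hs hs1
  obtain ⟨h1, h2⟩ := hconv p hp y hy s hs.le hs1
  have h3 := hmin _ h1
  have h7 := hdesc p ((1 - s) • p + s • y)
  have h4 : (1 - s) • p + s • y - p = s • (y - p) := by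
    rw [smul_sub, sub_smul, one_smul]; abel
  rw [h4, inner_smul_right, norm_smul, Real.norm_of_nonneg hs.le] at h7
  have : s * (r p - r y) ≤ s * (⟪f' p, y - p⟫ + s * (L / 2 * ‖y - p‖ ^ 2)) := by nlinarith
  exact le_of_mul_le_mul_left this hs

/-- Deterministic one step inequality. -/
lemma ms2gd_det_step (D : Set E) (r : E → ℝ)
    (f : E → ℝ) (f' : E → E) (L : ℝ)
    (hdesc : ∀ x y, f y ≤ f x + ⟪f' x, y - x⟫ + L / 2 * ‖y - x‖ ^ 2)
    (hfirst : ∀ x y, f x + ⟪f' x, y - x⟫ ≤ f y)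
    (h : ℝ) (hh0 : 0 < h) (hhL : h * L ≤ 1) (prox : E → E) (hpD : ∀ z, prox z ∈ D)
    (hprox : ∀ z, ∀ y ∈ D, ⟪z - prox z, y - prox z⟫ ≤ h * (r y - r (prox z)))
    (y x Δ : E) (hx : x ∈ D) :
    ‖prox (y - h • (f' y + Δ)) - x‖ ^ 2
      + 2 * h * (f (prox (y - h • (f' y + Δ))) + r (prox (y - h • (f' y + Δ))) - (f x + r x))
      ≤ ‖y - x‖ ^ 2 + 2 * h ^ 2 * ‖Δ‖ ^ 2 - 2 * h * ⟪Δ, prox (y - h • f' y) - x⟫ := by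
  set p := prox (y - h • (f' y + Δ)) with hp
  set q := prox (y - h • f' y) with hq
  have e1 := hprox (y - h • (f' y + Δ)) x hx
  have e2 := hprox (y - h • (f' y + Δ)) q (hpD _)
  have e3 := hprox (y - h • f' y) p (hpD _)
  rw [← hp] at e1 e2
  rw [← hq] at e3
  have e4 := hdesc y p
  have e5 := hfirst y x
  -- nonexpansiveness
  have n1 : ‖p - q‖ ^ 2 ≤ - h * ⟪Δ, p - q⟫ := by
    have a1 : ⟪y - h • (f' y + Δ) - p, q - p⟫ + ⟪y - h • f' y - q, p - q⟫
        = ‖p - q‖ ^ 2 + h * ⟪Δ, p - q⟫ := by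
      have : q - p = - (p - q) := by abel
      rw [this, inner_neg_right, neg_add_eq_sub, ← inner_sub_left]
      have : y - h • f' y - q - (y - h • (f' y + Δ) - p) = (p - q) + h • Δ := by
        rw [smul_add]; abel
      rw [this, inner_add_left, real_inner_self_eq_norm_sq, real_inner_smul_left]
    nlinarith
  have n2 : - ⟪Δ, p - q⟫ ≤ h * ‖Δ‖ ^ 2 := by
    have c1 : - ⟪Δ, p - q⟫ ≤ ‖Δ‖ * ‖p - q‖ := by
      have := neg_le_of_abs_le (abs_real_inner_le_norm Δ (p - q)); linarith
    have c2 : ‖p - q‖ ≤ h * ‖Δ‖ := by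
      by_contra hlt
      push Not at hlt
      have c3 : 0 < ‖p - q‖ := lt_of_le_of_lt (by positivity) hlt
      have c4 : ‖p - q‖ ^ 2 ≤ h * ‖Δ‖ * ‖p - q‖ := by nlinarith
      nlinarith
    have := mul_le_mul_of_nonneg_left c2 (norm_nonneg Δ)
    nlinarith
  have a2 : ⟪y - h • (f' y + Δ) - p, x - p⟫
      = - ⟪y - p, p - x⟫ + h * ⟪f' y, p - x⟫ + h * ⟪Δ, p - x⟫ := by
    have : y - h • (f' y + Δ) - p = (y - p) - h • (f' y + Δ) := by abel
    rw [this, ← neg_sub p x, inner_neg_right, inner_sub_left, real_inner_smul_left, inner_add_left]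
    ring
  have a3 : ‖y - x‖ ^ 2 = ‖p - y‖ ^ 2 + 2 * ⟪y - p, p - x⟫ + ‖p - x‖ ^ 2 := by
    have : y - x = (y - p) + (p - x) := by abel
    rw [this, norm_add_sq_real, norm_sub_rev y p]
  have a4 : ⟪f' y, p - y⟫ - ⟪f' y, x - y⟫ = ⟪f' y, p - x⟫ := by
    rw [← inner_sub_right]; congr 1; abel
  have a5 : ⟪Δ, p - x⟫ = ⟪Δ, p - q⟫ + ⟪Δ, q - x⟫ := by
    rw [← inner_add_right]; congr 1; abel
  have a6 : h * L * ‖p - y‖ ^ 2 ≤ 1 * ‖p - y‖ ^ 2 :=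
    mul_le_mul_of_nonneg_right hhL (by positivity)
  have a7 : 2 * h * (f p - f x) ≤ 2 * h * (⟪f' y, p - x⟫ + L / 2 * ‖p - y‖ ^ 2) :=
    mul_le_mul_of_nonneg_left (by linarith) (by linarith)
  have a8 : 2 * h * (- ⟪Δ, p - q⟫) ≤ 2 * h * (h * ‖Δ‖ ^ 2) :=
    mul_le_mul_of_nonneg_left n2 (by linarith)
  rw [a2, a5] at e1
  rw [a3]
  linarith

lemma ms2gd_center (n : ℕ) (hn : 0 < n) (a : Fin n → E) :
    ∑ i, ‖a i - (1 / (n : ℝ)) • ∑ j, a j‖ ^ 2 ≤ ∑ i, ‖a i‖ ^ 2 := by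
  set g := (1 / (n : ℝ)) • ∑ j, a j with hg
  have hs : ∑ j, a j = (n : ℝ) • g := by
    rw [hg, smul_smul, mul_one_div_cancel (by positivity), one_smul]
  simp_rw [norm_sub_sq_real]
  rw [Finset.sum_add_distrib, Finset.sum_sub_distrib, ← Finset.mul_sum, ← sum_inner, hs,
    real_inner_smul_left, real_inner_self_eq_norm_sq]
  simp
  have : 0 ≤ (n : ℝ) * ‖g‖ ^ 2 := by positivity
  linarith

/-- Expected one step inequality. -/
lemma ms2gd_exp_step (n b : ℕ) (hn : 2 ≤ n) (hb : 1 ≤ b) (hbn : b ≤ n)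
    (D : Set E) (r : E → ℝ)
    (fi : Fin n → E → ℝ) (fi' : Fin n → E → E)
    (f : E → ℝ) (f' : E → E) (L : ℝ) (hL : 0 < L)
    (hf : ∀ x, f x = (1 / (n : ℝ)) * ∑ i, fi i x)
    (hf' : ∀ x, f' x = (1 / (n : ℝ)) • ∑ i, fi' i x)
    (hcoco : ∀ i x y, ‖fi' i x - fi' i y‖ ^ 2 ≤ 2 * L * (fi i x - fi i y - ⟪fi' i y, x - y⟫))
    (hdesc : ∀ x y, f y ≤ f x + ⟪f' x, y - x⟫ + L / 2 * ‖y - x‖ ^ 2)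
    (hfirst : ∀ x y, f x + ⟪f' x, y - x⟫ ≤ f y)
    (h : ℝ) (hh0 : 0 < h) (hhL : h * L ≤ 1) (prox : E → E) (hpD : ∀ z, prox z ∈ D)
    (hprox : ∀ z, ∀ y ∈ D, ⟪z - prox z, y - prox z⟫ ≤ h * (r y - r (prox z)))
    (x : E) (hx : x ∈ D) (hopt : ∀ y ∈ D, r x - r y ≤ ⟪f' x, y - x⟫)
    (α : ℝ) (hα : α = ((n : ℝ) - (b : ℝ)) / ((b : ℝ) * ((n : ℝ) - 1)))
    (y w : E) (hy : y ∈ D) (hw : w ∈ D) (Y : Finset (Fin n) → E)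
    (hY : ∀ A, Y A = prox (y - h • (f' w + (1 / (b : ℝ)) • ∑ i ∈ A, (fi' i y - fi' i w)))) :
    ∑ A, ms2gdP n b A * (‖Y A - x‖ ^ 2 + 2 * h * (f (Y A) + r (Y A) - (f x + r x)))
      ≤ ‖y - x‖ ^ 2 + 8 * h ^ 2 * L * α *
        ((f y + r y - (f x + r x)) + (f w + r w - (f x + r x))) := by
  have hn2 : (2 : ℝ) ≤ n := by exact_mod_cast hn
  have hb1 : (1 : ℝ) ≤ b := by exact_mod_cast hb
  have hbn' : (b : ℝ) ≤ n := by exact_mod_cast hbn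
  have hn0 : (n : ℝ) ≠ 0 := by linarith
  have hα0 : 0 ≤ α := by
    rw [hα]; apply div_nonneg (by linarith); apply mul_nonneg <;> linarith
  set c : Fin n → E := fun i => (fi' i y - fi' i w) - (f' y - f' w) with hcdef
  have hmean : f' y - f' w = (1 / (n : ℝ)) • ∑ i, (fi' i y - fi' i w) := by
    rw [hf', hf', Finset.sum_sub_distrib, smul_sub]
  have hc0 : ∑ i, c i = 0 := by
    simp only [hcdef]
    rw [Finset.sum_sub_distrib, Finset.sum_const, Finset.card_univ, Fintype.card_fin, hmean,
      ← Nat.cast_smul_eq_nsmul ℝ, smul_smul, mul_one_div_cancel hn0, one_smul, sub_self]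
  set q := prox (y - h • f' y) with hq
  set S : Finset (Fin n) → E := fun A => ∑ i ∈ A, c i with hS
  have hpt : ∀ A, ms2gdP n b A * (‖Y A - x‖ ^ 2 + 2 * h * (f (Y A) + r (Y A) - (f x + r x)))
      ≤ ms2gdP n b A * (‖y - x‖ ^ 2) + 2 * h ^ 2 * (1 / (b : ℝ)) ^ 2 * (ms2gdP n b A * ‖S A‖ ^ 2)
        - 2 * h * (1 / (b : ℝ)) * ⟪ms2gdP n b A • S A, q - x⟫ := by
    intro A
    by_cases hA : A.card = b
    · have e : f' w + (1 / (b : ℝ)) • ∑ i ∈ A, (fi' i y - fi' i w)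
          = f' y + (1 / (b : ℝ)) • S A := by
        simp only [hS, hcdef]
        rw [Finset.sum_sub_distrib (s := A) (f := fun i => fi' i y - fi' i w),
          Finset.sum_const, hA, ← Nat.cast_smul_eq_nsmul ℝ, smul_sub, smul_smul,
          one_div_mul_cancel (by linarith), one_smul]
        abel
      have := ms2gd_det_step D r f f' L hdesc hfirst h hh0 hhL prox hpD hprox y x
        ((1 / (b : ℝ)) • S A) hx
      rw [← e, ← hY, real_inner_smul_left, norm_smul, Real.norm_of_nonneg (by positivity)] at this
      have := mul_le_mul_of_nonneg_left this (ms2gdP_nonneg n b A)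
      rw [real_inner_smul_left]
      refine this.trans (le_of_eq ?_)
      ring
    · simp [ms2gdP, hA]
  have hsum := Finset.sum_le_sum (fun A (_ : A ∈ Finset.univ) => hpt A)
  refine hsum.trans ?_
  rw [Finset.sum_sub_distrib, Finset.sum_add_distrib, ← Finset.sum_mul, ms2gdP_sum n b hbn,
    ← Finset.mul_sum, ← Finset.mul_sum, ← sum_inner]
  simp only [hS]
  rw [ms2gdP_mean n b hb hbn c hc0, ms2gdP_var n b hn hb hbn c hc0, inner_zero_left]
  have hbreg : ∀ z ∈ D, 1 / (n : ℝ) * ∑ i, ‖fi' i z - fi' i x‖ ^ 2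
      ≤ 2 * L * (f z + r z - (f x + r x)) := by
    intro z hz
    have h1 : ∑ i, ‖fi' i z - fi' i x‖ ^ 2
        ≤ 2 * L * (∑ i, fi i z - ∑ i, fi i x - ⟪∑ i, fi' i x, z - x⟫) := by
      refine (Finset.sum_le_sum fun i _ => hcoco i z x).trans (le_of_eq ?_)
      rw [← Finset.mul_sum, Finset.sum_sub_distrib, Finset.sum_sub_distrib, sum_inner]
    have h2 := mul_le_mul_of_nonneg_left h1 (by positivity : 0 ≤ 1 / (n : ℝ))
    have h3 := hopt z hz
    rw [hf', real_inner_smul_left] at h3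
    rw [hf z, hf x]
    refine h2.trans ?_
    have := mul_le_mul_of_nonneg_left h3 (by positivity : 0 ≤ 2 * L)
    nlinarith
  have hv : 1 / (n : ℝ) * ∑ i, ‖c i‖ ^ 2
      ≤ 4 * L * ((f y + r y - (f x + r x)) + (f w + r w - (f x + r x))) := by
    have h1 : ∑ i, ‖c i‖ ^ 2 ≤ ∑ i, ‖fi' i y - fi' i w‖ ^ 2 := by
      simp only [hcdef, hmean]
      exact ms2gd_center n (by omega) _
    have h2 : ∑ i, ‖fi' i y - fi' i w‖ ^ 2
        ≤ 2 * ∑ i, ‖fi' i y - fi' i x‖ ^ 2 + 2 * ∑ i, ‖fi' i w - fi' i x‖ ^ 2 := by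
      rw [Finset.mul_sum, Finset.mul_sum, ← Finset.sum_add_distrib]
      refine Finset.sum_le_sum fun i _ => ?_
      have e : fi' i y - fi' i w = (fi' i y - fi' i x) - (fi' i w - fi' i x) := by abel
      rw [e]
      have := norm_sub_le (fi' i y - fi' i x) (fi' i w - fi' i x)
      have h0 := norm_nonneg ((fi' i y - fi' i x) - (fi' i w - fi' i x))
      nlinarith [sq_nonneg (‖fi' i y - fi' i x‖ - ‖fi' i w - fi' i x‖)]
    have h3 := mul_le_mul_of_nonneg_left (h1.trans h2) (by positivity : 0 ≤ 1 / (n : ℝ))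
    have h4 := hbreg y hy
    have h5 := hbreg w hw
    linarith
  have hfin := mul_le_mul_of_nonneg_left hv (by positivity : 0 ≤ 2 * h ^ 2 * α)
  have hcoef : 2 * h ^ 2 * (1 / (b : ℝ)) ^ 2 * ((b : ℝ) * (n - b) / (n * (n - 1)) * ∑ i, ‖c i‖ ^ 2)
      = 2 * h ^ 2 * α * (1 / (n : ℝ) * ∑ i, ‖c i‖ ^ 2) := by
    rw [hα]
    have h6 : (n:ℝ) - 1 ≠ 0 := by linarith
    have h7 : (b:ℝ) ≠ 0 := by linarith
    field_simp
  rw [hcoef]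
  linarith
end

section
variable {Y S : Type*} [Fintype S]

/-- Averaging operator. -/
def ms2gdK (p : S → ℝ) (s : S → Y → Y) : (Y → ℝ) →ₗ[ℝ] (Y → ℝ) where
  toFun Φ := fun y => ∑ a, p a * Φ (s a y)
  map_add' Φ Ψ := by
    ext y; simp [mul_add, Finset.sum_add_distrib]
  map_smul' c Φ := by
    ext y; simp [Finset.mul_sum]; refine Finset.sum_congr rfl fun a _ => by ring

lemma ms2gdK_apply (p : S → ℝ) (s : S → Y → Y) (Φ : Y → ℝ) (y : Y) :
    ms2gdK p s Φ y = ∑ a, p a * Φ (s a y) := rfl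

lemma ms2gd_fold_K (p : S → ℝ) (hp : ∑ a, p a = 1) (s : S → Y → Y) (Φ : Y → ℝ) (m : ℕ) :
    ∀ (T : ℕ) (_ : T ≤ m) (y : Y),
    ∑ σ : Fin m → S, (∏ t, p (σ t)) *
      Φ ((List.finRange m).foldl (fun y (t : Fin m) => if (t : ℕ) < T then s (σ t) y else y) y)
      = ((ms2gdK p s) ^ T) Φ y := by
  induction m with
  | zero =>
    intro T hT y
    obtain rfl : T = 0 := by omega
    simp
  | succ m ih =>
    intro T hT y
    rw [← (Fin.consEquiv (fun _ => S)).sum_comp, Fintype.sum_prod_type]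
    simp only [Fin.consEquiv_apply, Fin.prod_univ_succ, List.finRange_succ, List.foldl_cons,
      List.foldl_map, Fin.cons_zero, Fin.cons_succ, Fin.val_succ, Fin.val_zero]
    cases T with
    | zero =>
      have := ih 0 (Nat.zero_le _) y
      simp only [Nat.not_lt_zero, if_false] at this ⊢
      simp_rw [mul_assoc, ← Finset.mul_sum, this, ← Finset.sum_mul, hp, one_mul]
    | succ T =>
      have := ih T (by omega)
      simp only [Nat.succ_pos, if_true, Nat.add_lt_add_iff_right]
      simp_rw [mul_assoc, ← Finset.mul_sum, this]
      rw [pow_succ', Module.End.mul_apply, ms2gdK_apply]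

lemma ms2gd_fold_K' (p : S → ℝ) (hp : ∑ a, p a = 1) (s : S → Y → Y) (Φ : Y → ℝ) (m : ℕ) (y : Y) :
    ∑ σ : Fin m → S, (∏ t, p (σ t)) *
      Φ ((List.finRange m).foldl (fun y (t : Fin m) => s (σ t) y) y)
      = ((ms2gdK p s) ^ m) Φ y := by
  rw [← ms2gd_fold_K p hp s Φ m m le_rfl y]
  simp

lemma ms2gdK_pow_mono (p : S → ℝ) (hp : ∀ a, 0 ≤ p a) (s : S → Y → Y) (D : Set Y)
    (hs : ∀ a, ∀ y ∈ D, s a y ∈ D) (T : ℕ) :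
    ∀ (Φ Ψ : Y → ℝ) (_ : ∀ y ∈ D, Φ y ≤ Ψ y), ∀ y ∈ D,
      ((ms2gdK p s) ^ T) Φ y ≤ ((ms2gdK p s) ^ T) Ψ y := by
  induction T with
  | zero => intro Φ Ψ H y hy; simpa using H y hy
  | succ T ih =>
    intro Φ Ψ H y hy
    rw [pow_succ', Module.End.mul_apply, Module.End.mul_apply, ms2gdK_apply, ms2gdK_apply]
    exact Finset.sum_le_sum fun a _ => mul_le_mul_of_nonneg_left (ih Φ Ψ H _ (hs a y hy)) (hp a)

lemma ms2gdK_pow_one (p : S → ℝ) (hp : ∑ a, p a = 1) (s : S → Y → Y) (T : ℕ) (y : Y) :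
    ((ms2gdK p s) ^ T) (fun _ => 1) y = 1 := by
  have h1 : ms2gdK p s (fun _ => 1) = fun _ => 1 := by
    ext y; simp [ms2gdK_apply, hp]
  induction T with
  | zero => simp
  | succ T ih => rw [pow_succ, Module.End.mul_apply, h1, ih]

lemma ms2gdK_pow_le (p : S → ℝ) (hp : ∀ a, 0 ≤ p a) (s : S → Y → Y) (D : Set Y)
    (hs : ∀ a, ∀ y ∈ D, s a y ∈ D) (Φ : Y → ℝ) (c : ℝ) (hc : 0 ≤ c)
    (H : ∀ y ∈ D, ms2gdK p s Φ y ≤ c * Φ y) (k : ℕ) :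
    ∀ y ∈ D, ((ms2gdK p s) ^ k) Φ y ≤ c ^ k * Φ y := by
  induction k with
  | zero => intro y hy; simp
  | succ k ih =>
    intro y hy
    rw [pow_succ, Module.End.mul_apply]
    have h1 := ms2gdK_pow_mono p hp s D hs k (ms2gdK p s Φ) (c • Φ) (fun y hy => H y hy) y hy
    rw [map_smul] at h1
    refine h1.trans ?_
    have := mul_le_mul_of_nonneg_left (ih y hy) hc
    simp only [Pi.smul_apply, smul_eq_mul]
    refine this.trans (le_of_eq (by ring))

/-- Telescoped inequality over one epoch. -/
lemma ms2gd_epoch_sum (p : S → ℝ) (hp : ∀ a, 0 ≤ p a) (hp1 : ∑ a, p a = 1) (s : S → Y → Y)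
    (D : Set Y) (hs : ∀ a, ∀ y ∈ D, s a y ∈ D) (V Φ : Y → ℝ) (hV : ∀ y ∈ D, 0 ≤ V y)
    (hΦ : ∀ y ∈ D, 0 ≤ Φ y) (h β : ℝ) (hβ : 0 ≤ β) (w : Y) (hw : w ∈ D)
    (H : ∀ y ∈ D, ms2gdK p s (V + (2 * h) • Φ) y ≤ V y + β * (Φ y + Φ w)) (m : ℕ) :
    (2 * h - β) * ∑ t ∈ Finset.range m, ((ms2gdK p s) ^ (t + 1)) Φ w
      ≤ V w + β * (m + 1) * Φ w := by
  have hstep : ∀ t, ((ms2gdK p s) ^ (t+1)) V w + 2 * h * ((ms2gdK p s) ^ (t+1)) Φ w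
      ≤ ((ms2gdK p s) ^ t) V w + β * ((ms2gdK p s) ^ t) Φ w + β * Φ w := by
    intro t
    have h1 := ms2gdK_pow_mono p hp s D hs t (ms2gdK p s (V + (2 * h) • Φ)) (V + β • Φ + (β * Φ w) • (fun _ => (1:ℝ)))
      (fun y hy => by
        have := H y hy
        simp only [Pi.add_apply, Pi.smul_apply, smul_eq_mul]
        linarith) w hw
    rw [← Module.End.mul_apply, ← pow_succ, map_add, map_add, map_add, map_smul, map_smul,
      map_smul] at h1
    simp only [Pi.add_apply, Pi.smul_apply, smul_eq_mul, ms2gdK_pow_one p hp1] at h1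
    linarith
  have hnn : ∀ (F : Y → ℝ) (_ : ∀ y ∈ D, 0 ≤ F y) t, 0 ≤ ((ms2gdK p s) ^ t) F w := by
    intro F hF t
    have := ms2gdK_pow_mono p hp s D hs t 0 F hF w hw
    simpa using this
  have hind : ((ms2gdK p s) ^ m) V w + β * ((ms2gdK p s) ^ m) Φ w
      + (2 * h - β) * ∑ t ∈ Finset.range m, ((ms2gdK p s) ^ (t + 1)) Φ w
      ≤ V w + β * (m + 1) * Φ w := by
    induction m with
    | zero => simp
    | succ m ih =>
      rw [Finset.sum_range_succ]
      have := hstep m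
      push_cast
      linarith
  have := hnn V hV m
  have := mul_nonneg hβ (hnn Φ hΦ m)
  linarith
end

/-- **Linear convergence of mS2GD in expectation** (Theorem 4.3 of Konečný's thesis).
Let `R : ℝ^d → ℝ ∪ {+∞}` be proper closed convex with proximal operator `prox`,
`f = (1/n) ∑ f_i` with convex `L`-smooth `f_i`, and let `P = f + R` be `μ`-strongly convex
(via subgradients) with minimizer `w*`.  If `0 < h ≤ 1/L`, `4hLα(b) < 1` and
`c = 1/(mhμ(1−4hLα(b))) + 4hLα(b)(m+1)/(m(1−4hLα(b))) < 1`, `α(b) = (n−b)/(b(n−1))`,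
then `E[P(w^k) − P(w*)] ≤ c^k (P(w^0) − P(w*))` for all `k ≥ 0`. -/
theorem ms2gd_linear_convergence
    (d n : ℕ) (hn : 2 ≤ n)
    (R : EuclideanSpace ℝ (Fin d) → EReal)
    (hRbot : ∀ x, R x ≠ ⊥)
    (hRproper : ∃ x, R x ≠ ⊤)
    (hRconvex : ∀ (x y : EuclideanSpace ℝ (Fin d)) (s t : ℝ), 0 ≤ s → 0 ≤ t → s + t = 1 →
      R (s • x + t • y) ≤ (s : EReal) * R x + (t : EReal) * R y)
    (hRclosed : LowerSemicontinuous R)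
    (f : Fin n → EuclideanSpace ℝ (Fin d) → ℝ)
    (f' : Fin n → EuclideanSpace ℝ (Fin d) → EuclideanSpace ℝ (Fin d))
    (hgrad : ∀ i x, HasGradientAt (f i) (f' i x) x)
    (hconvex : ∀ i, ConvexOn ℝ Set.univ (f i))
    (L : ℝ) (hL : 0 < L)
    (hLip : ∀ i (x y : EuclideanSpace ℝ (Fin d)), ‖f' i x - f' i y‖ ≤ L * ‖x - y‖)
    (fbar : EuclideanSpace ℝ (Fin d) → ℝ)
    (hfbar : ∀ x, fbar x = (1 / (n : ℝ)) * ∑ i, f i x)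
    (fbar' : EuclideanSpace ℝ (Fin d) → EuclideanSpace ℝ (Fin d))
    (hfbar' : ∀ x, fbar' x = (1 / (n : ℝ)) • ∑ i, f' i x)
    (P : EuclideanSpace ℝ (Fin d) → EReal)
    (hPdef : ∀ x, P x = (fbar x : EReal) + R x)
    (μ : ℝ) (hμ : 0 < μ)
    (hstrong : ∀ (x y ξ : EuclideanSpace ℝ (Fin d)), R x ≠ ⊤ → R y ≠ ⊤ →
      (∀ z, P x + ((⟪ξ, z - x⟫ : ℝ) : EReal) ≤ P z) →
      P x + ((⟪ξ, y - x⟫ + μ / 2 * ‖y - x‖ ^ 2 : ℝ) : EReal) ≤ P y)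
    (wstar : EuclideanSpace ℝ (Fin d)) (hmin : ∀ x, P wstar ≤ P x)
    (h : ℝ) (hh0 : 0 < h) (hhL : h ≤ 1 / L)
    (prox : EuclideanSpace ℝ (Fin d) → EuclideanSpace ℝ (Fin d))
    (hprox : ∀ z w : EuclideanSpace ℝ (Fin d),
      ((1 / 2 * ‖prox z - z‖ ^ 2 : ℝ) : EReal) + (h : EReal) * R (prox z)
        ≤ ((1 / 2 * ‖w - z‖ ^ 2 : ℝ) : EReal) + (h : EReal) * R w)
    (b : ℕ) (hb1 : 1 ≤ b) (hbn : b ≤ n)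
    (α : ℝ) (hα : α = ((n : ℝ) - (b : ℝ)) / ((b : ℝ) * ((n : ℝ) - 1)))
    (hαh : 4 * h * L * α < 1)
    (m : ℕ) (hm : 1 ≤ m)
    (c : ℝ)
    (hc : c = 1 / ((m : ℝ) * h * μ * (1 - 4 * h * L * α))
        + 4 * h * L * α * ((m : ℝ) + 1) / ((m : ℝ) * (1 - 4 * h * L * α)))
    (hc1 : c < 1)
    (w0 : EuclideanSpace ℝ (Fin d)) (k : ℕ) :
    ∑ ω : Fin k → Fin m × (Fin m → Finset (Fin n)),
        ((ms2gdWeight n b m ω : ℝ) : EReal) *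
          (P (ms2gdIterate f' fbar' prox h b m w0 k ω) - P wstar)
      ≤ ((c ^ k : ℝ) : EReal) * (P w0 - P wstar) := by
  classical
  set D : Set (EuclideanSpace ℝ (Fin d)) := {x | R x ≠ ⊤} with hD
  set r : EuclideanSpace ℝ (Fin d) → ℝ := fun x => (R x).toReal with hr
  have hR : ∀ x ∈ D, R x = (r x : EReal) := fun x hx => (EReal.coe_toReal hx (hRbot x)).symm
  have hP : ∀ x ∈ D, P x = ((fbar x + r x : ℝ) : EReal) := by
    intro x hx
    rw [hPdef, hR x hx, EReal.coe_add]
  have hPtop : ∀ x, x ∉ D → P x = ⊤ := by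
    intro x hx
    have : R x = ⊤ := by simpa [hD] using hx
    rw [hPdef, this, EReal.coe_add_top]
  obtain ⟨x0, hx0⟩ := hRproper
  have hx0 : x0 ∈ D := hx0
  have hwsD : wstar ∈ D := by
    by_contra hcon
    have := hmin x0
    rw [hPtop _ hcon, hP _ hx0, top_le_iff] at this
    exact EReal.coe_ne_top _ this
  have hconv : ∀ x ∈ D, ∀ y ∈ D, ∀ s : ℝ, 0 ≤ s → s ≤ 1 →
      (1 - s) • x + s • y ∈ D ∧ r ((1 - s) • x + s • y) ≤ (1 - s) * r x + s * r y := by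
    intro x hx y hy s hs hs1
    have h1 := hRconvex x y (1 - s) s (by linarith) hs (by ring)
    rw [hR x hx, hR y hy, ← EReal.coe_mul, ← EReal.coe_mul, ← EReal.coe_add] at h1
    have h2 : (1 - s) • x + s • y ∈ D := by
      intro hcon
      rw [hcon, top_le_iff] at h1
      exact EReal.coe_ne_top _ h1
    refine ⟨h2, ?_⟩
    rw [hR _ h2] at h1
    exact_mod_cast h1
  have hpD : ∀ z, prox z ∈ D := by
    intro z hcon
    have h1 := hprox z x0
    rw [hcon, EReal.coe_mul_top_of_pos hh0, EReal.coe_add_top, hR _ hx0, ← EReal.coe_mul,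
      ← EReal.coe_add, top_le_iff] at h1
    exact EReal.coe_ne_top _ h1
  have hprox' : ∀ z, ∀ y ∈ D, ⟪z - prox z, y - prox z⟫ ≤ h * (r y - r (prox z)) := by
    intro z y hy
    apply ms2gd_prox_ineq D r hconv h hh0 z (prox z) (hpD z) _ y hy
    intro w hw
    have h1 := hprox z w
    rw [hR _ (hpD z), hR _ hw, ← EReal.coe_mul, ← EReal.coe_mul, ← EReal.coe_add,
      ← EReal.coe_add] at h1
    exact_mod_cast h1
  have hmin' : ∀ x ∈ D, fbar wstar + r wstar ≤ fbar x + r x := by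
    intro x hx
    have := hmin x
    rw [hP _ hx, hP _ hwsD] at this
    exact_mod_cast this
  have hn0 : (0 : ℝ) < n := by
    have : 0 < n := by omega
    exact_mod_cast this
  have hm0 : (0 : ℝ) < m := by exact_mod_cast hm
  have hdesc : ∀ x y, fbar y ≤ fbar x + ⟪fbar' x, y - x⟫ + L / 2 * ‖y - x‖ ^ 2 := by
    intro x y
    have h1 := Finset.sum_le_sum fun i (_ : i ∈ Finset.univ) =>
      ms2gd_descent (f i) (f' i) (hgrad i) L (hLip i) x y
    rw [Finset.sum_add_distrib, Finset.sum_add_distrib, ← sum_inner, Finset.sum_const,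
      Finset.card_univ, Fintype.card_fin, nsmul_eq_mul] at h1
    have h2 := mul_le_mul_of_nonneg_left h1 (by positivity : 0 ≤ 1 / (n : ℝ))
    rw [hfbar, hfbar, hfbar', real_inner_smul_left]
    refine h2.trans (le_of_eq ?_)
    field_simp
  have hfirst : ∀ x y, fbar x + ⟪fbar' x, y - x⟫ ≤ fbar y := by
    intro x y
    have h1 := Finset.sum_le_sum fun i (_ : i ∈ Finset.univ) =>
      ms2gd_firstorder (f i) (f' i) (hgrad i) L (hLip i) (hconvex i) x y
    rw [Finset.sum_add_distrib, ← sum_inner] at h1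
    have h2 := mul_le_mul_of_nonneg_left h1 (by positivity : 0 ≤ 1 / (n : ℝ))
    rw [hfbar, hfbar, hfbar', real_inner_smul_left]
    linarith
  have hhL' : h * L ≤ 1 := by rwa [le_div_iff₀ hL] at hhL
  have hopt := ms2gd_opt D r hconv fbar fbar' L hdesc wstar hwsD hmin'
  have hα0 : 0 ≤ α := by
    have h1 : (2 : ℝ) ≤ n := by exact_mod_cast hn
    have h3 : (b : ℝ) ≤ n := by exact_mod_cast hbn
    rw [hα]; apply div_nonneg (by linarith); apply mul_nonneg (by positivity); linarith
  have hδ : 0 < 1 - 4 * h * L * α := by linarith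
  have hc0 : 0 < c := by
    rw [hc]
    have : 0 < 1 / ((m : ℝ) * h * μ * (1 - 4 * h * L * α)) := by positivity
    have : 0 ≤ 4 * h * L * α * ((m : ℝ) + 1) / ((m : ℝ) * (1 - 4 * h * L * α)) := by positivity
    linarith
  set Φ : EuclideanSpace ℝ (Fin d) → ℝ := fun x => fbar x + r x - (fbar wstar + r wstar) with hΦ
  have hPΦ : ∀ x ∈ D, P x - P wstar = ((Φ x : ℝ) : EReal) := by
    intro x hx
    rw [hP x hx, hP _ hwsD, ← EReal.coe_sub]
  by_cases hw0 : w0 ∈ D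
  swap
  · rw [hPtop _ hw0, hP _ hwsD, EReal.top_sub_coe, EReal.coe_mul_top_of_pos (pow_pos hc0 k)]
    exact le_top
  have hΦ0 : ∀ y ∈ D, 0 ≤ Φ y := fun y hy => by
    have := hmin' y hy
    simp only [hΦ]; linarith
  have hstr : ∀ y ∈ D, ‖y - wstar‖ ^ 2 ≤ 2 / μ * Φ y := by
    intro y hy
    have h1 := hstrong wstar y 0 hwsD hy (fun z => by
      simpa using hmin z)
    rw [hP _ hwsD, hP _ hy, ← EReal.coe_add, inner_zero_left, zero_add] at h1
    have h2 : fbar wstar + r wstar + μ / 2 * ‖y - wstar‖ ^ 2 ≤ fbar y + r y := by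
      exact_mod_cast h1
    have h3 : μ / 2 * ‖y - wstar‖ ^ 2 ≤ Φ y := by simp only [hΦ]; linarith
    have h4 := mul_le_mul_of_nonneg_left h3 (by positivity : 0 ≤ 2 / μ)
    refine le_trans (le_of_eq ?_) h4
    field_simp
  -- inner step
  have hinnD : ∀ w A y, ms2gdInnerStep f' prox h b w (fbar' w) A y ∈ D := fun w A y => hpD _
  have hp1 := ms2gdP_sum n b hbn
  set q : Fin m × (Fin m → Finset (Fin n)) → ℝ :=
    fun s => 1 / (m : ℝ) * ∏ t, ms2gdP n b (s.2 t) with hq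
  have hq0 : ∀ s, 0 ≤ q s := fun s =>
    mul_nonneg (by positivity) (Finset.prod_nonneg fun t _ => ms2gdP_nonneg n b _)
  have hprod : ∑ σ : Fin m → Finset (Fin n), ∏ t, ms2gdP n b (σ t) = 1 := by
    have := ms2gd_fold_K (ms2gdP n b) hp1 (fun _ (y : ℝ) => y) (fun _ => 1) m 0 (Nat.zero_le _) 0
    simpa using this
  have hq1 : ∑ s, q s = 1 := by
    rw [Fintype.sum_prod_type]
    simp only [hq, ← Finset.mul_sum, hprod]
    simp
    field_simp
  set st : Fin m × (Fin m → Finset (Fin n)) → EuclideanSpace ℝ (Fin d) → EuclideanSpace ℝ (Fin d) :=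
    fun s w => ms2gdEpoch f' fbar' prox h b m w ((s.1 : ℕ) + 1) s.2 with hst
  have hstD : ∀ s, ∀ w ∈ D, st s w ∈ D := by
    intro s w hw
    simp only [hst, ms2gdEpoch]
    have : ∀ (l : List (Fin m)) (y : EuclideanSpace ℝ (Fin d)), y ∈ D →
        l.foldl (fun y (t : Fin m) => if (t : ℕ) < (s.1 : ℕ) + 1 then
          ms2gdInnerStep f' prox h b w (fbar' w) (s.2 t) y else y) y ∈ D := by
      intro l
      induction l with
      | nil => intro y hy; simpa using hy
      | cons a l ih =>
        intro y hy
        rw [List.foldl_cons]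
        apply ih
        split_ifs
        · exact hinnD _ _ _
        · exact hy
    exact this _ w hw
  have hepoch : ∀ w ∈ D, ms2gdK q st Φ w ≤ c * Φ w := by
    intro w hw
    have hsum := ms2gd_epoch_sum (ms2gdP n b) (ms2gdP_nonneg n b) hp1
      (fun A y => ms2gdInnerStep f' prox h b w (fbar' w) A y) D (fun A y _ => hinnD w A y)
      (fun y => ‖y - wstar‖ ^ 2) Φ (fun y _ => by positivity) hΦ0 h (8 * h ^ 2 * L * α)
      (by positivity) w hw
      (by
        intro y hy
        exact ms2gd_exp_step n b hn hb1 hbn D r f f' fbar fbar' L hL hfbar hfbar'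
          (fun i x y => ms2gd_coco (f i) (f' i) (hgrad i) L hL (hLip i) (hconvex i) x y)
          hdesc hfirst h hh0 hhL' prox hpD hprox' wstar hwsD hopt α hα y w hy hw _
          (fun A => rfl)) m
    have hK : ms2gdK q st Φ w = 1 / (m : ℝ) * ∑ t ∈ Finset.range m,
        ((ms2gdK (ms2gdP n b) (fun A y => ms2gdInnerStep f' prox h b w (fbar' w) A y)) ^ (t + 1))
          Φ w := by
      rw [ms2gdK_apply, Fintype.sum_prod_type, Finset.sum_range, Finset.mul_sum]
      refine Finset.sum_congr rfl fun T _ => ?_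
      rw [← ms2gd_fold_K (ms2gdP n b) hp1 _ Φ m (T + 1) (by omega) w, Finset.mul_sum]
      refine Finset.sum_congr rfl fun σ _ => ?_
      simp only [hq, hst, ms2gdEpoch, mul_assoc]
    rw [hK]
    set S := ∑ t ∈ Finset.range m,
        ((ms2gdK (ms2gdP n b) (fun A y => ms2gdInnerStep f' prox h b w (fbar' w) A y)) ^ (t + 1))
          Φ w with hS
    have h1 := hstr w hw
    have h2 : (2 * h - 8 * h ^ 2 * L * α) * S ≤ (2 * h - 8 * h ^ 2 * L * α) * (m * (c * Φ w)) := by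
      have : (2 * h - 8 * h ^ 2 * L * α) * (m * (c * Φ w))
          = 2 / μ * Φ w + 8 * h ^ 2 * L * α * (m + 1) * Φ w := by
        have e : 2 * h - 8 * h ^ 2 * L * α = 2 * h * (1 - 4 * h * L * α) := by ring
        rw [e, hc]
        set δ := 1 - 4 * h * L * α
        field_simp
        ring
      rw [this]
      linarith
    have h3 : 0 < 2 * h - 8 * h ^ 2 * L * α := by
      have := mul_pos hh0 hδ
      nlinarith
    have h4 := le_of_mul_le_mul_left h2 h3
    have h5 := mul_le_mul_of_nonneg_left h4 (by positivity : 0 ≤ 1 / (m : ℝ))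
    refine h5.trans (le_of_eq ?_)
    field_simp
  have hmain := ms2gdK_pow_le q hq0 st D hstD Φ c hc0.le hepoch k w0 hw0
  rw [← ms2gd_fold_K' q hq1 st Φ k w0] at hmain
  have hitD : ∀ ω, ms2gdIterate f' fbar' prox h b m w0 k ω ∈ D := by
    intro ω
    have : ∀ (l : List (Fin k)) (y : EuclideanSpace ℝ (Fin d)), y ∈ D →
        l.foldl (fun w j => st (ω j) w) y ∈ D := by
      intro l
      induction l with
      | nil => intro y hy; simpa using hy
      | cons a l ih =>
        intro y hy
        rw [List.foldl_cons]
        exact ih _ (hstD _ _ hy)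
    exact this _ w0 hw0
  have hterm : ∀ ω : Fin k → Fin m × (Fin m → Finset (Fin n)),
      ((ms2gdWeight n b m ω : ℝ) : EReal) *
          (P (ms2gdIterate f' fbar' prox h b m w0 k ω) - P wstar)
      = (((∏ j, q (ω j)) *
        Φ ((List.finRange k).foldl (fun w j => st (ω j) w) w0) : ℝ) : EReal) := by
    intro ω
    rw [hPΦ _ (hitD ω), ← EReal.coe_mul]
    rfl
  rw [Finset.sum_congr rfl fun ω _ => hterm ω, hPΦ w0 hw0, ← EReal.coe_mul]
  have hcs : ∀ (s : Finset (Fin k → Fin m × (Fin m → Finset (Fin n))))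
      (g : (Fin k → Fin m × (Fin m → Finset (Fin n))) → ℝ),
      ∑ ω ∈ s, ((g ω : ℝ) : EReal) = ((∑ ω ∈ s, g ω : ℝ) : EReal) := by
    intro s g
    induction s using Finset.induction_on with
    | empty => simp
    | insert a s ha ih => rw [Finset.sum_insert ha, Finset.sum_insert ha, ih, EReal.coe_add]
  rw [hcs]
  exact_mod_cast hmain
end
end

section
/- Let h̃_b := sqrt( ((1 + c)/(cμ))² + 1/(4μ α(b) L) ) − (1 + c)/(cμ). Then h̃_b ∈ I, and: (i) if h̃_b ≤ 1/L, then h̃_b minimizes m(h) over I ∩ (0, 1/L], and the minimal value is m(h̃_b) = (2κ/c) ( (1 + 1/c)·4α(b) + sqrt( 4α(b)/κ + (1 + 1/c)²·(4α(b))² ) ); (ii) if h̃_b > 1/L, then c − 4α(b)(1 + c) > 0, the point h = 1/L minimizes m(h) over I ∩ (0, 1/L], and m(1/L) = (κ + 4α(b)) / ( c − 4α(b)(1 + c) ). -/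
open scoped BigOperators

/-- **Optimal stepsize and epoch length for mS2GD** (Theorem 4.4 of Konečný's thesis).
Fix `n ≥ 2`, `1 ≤ b < n`, `0 < μ ≤ L` and `c ∈ (0, 1)`, and set `α = (n−b)/(b(n−1))`,
`κ = L/μ`.  On `I = (0, (1/(4αL)) · c/(c+1))` define
`m(h) = (1 + 4αh²Lμ)/(hμ(c − 4αhL(1+c)))`, and let
`h̃ = sqrt(((1+c)/(cμ))² + 1/(4μαL)) − (1+c)/(cμ)`.  Then `h̃ ∈ I`, and:
(i) if `h̃ ≤ 1/L`, then `h̃` minimizes `m` over `I ∩ (0, 1/L]` with minimal value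
`(2κ/c)((1 + 1/c)·4α + sqrt(4α/κ + (1 + 1/c)²(4α)²))`;
(ii) if `h̃ > 1/L`, then `c − 4α(1+c) > 0`, the point `1/L` minimizes `m` over
`I ∩ (0, 1/L]`, and `m(1/L) = (κ + 4α)/(c − 4α(1+c))`. -/
theorem ms2gd_optimal_stepsize
    (n b : ℕ) (hn : 2 ≤ n) (hb1 : 1 ≤ b) (hbn : b < n)
    (μ L : ℝ) (hμ : 0 < μ) (hμL : μ ≤ L)
    (c : ℝ) (hc0 : 0 < c) (hc1 : c < 1)
    (α : ℝ) (hα : α = ((n : ℝ) - (b : ℝ)) / ((b : ℝ) * ((n : ℝ) - 1)))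
    (κ : ℝ) (hκ : κ = L / μ)
    (I : Set ℝ) (hI : I = Set.Ioo 0 (1 / (4 * α * L) * (c / (c + 1))))
    (mfun : ℝ → ℝ)
    (hmfun : ∀ h : ℝ,
      mfun h = (1 + 4 * α * h ^ 2 * L * μ) / (h * μ * (c - 4 * α * h * L * (1 + c))))
    (htil : ℝ)
    (hhtil : htil = Real.sqrt (((1 + c) / (c * μ)) ^ 2 + 1 / (4 * μ * α * L))
        - (1 + c) / (c * μ)) :
    htil ∈ I
    ∧ (htil ≤ 1 / L →
        htil ∈ I ∩ Set.Ioc 0 (1 / L)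
        ∧ IsMinOn mfun (I ∩ Set.Ioc 0 (1 / L)) htil
        ∧ mfun htil = 2 * κ / c *
            ((1 + 1 / c) * (4 * α)
              + Real.sqrt (4 * α / κ + (1 + 1 / c) ^ 2 * (4 * α) ^ 2)))
    ∧ (1 / L < htil →
        0 < c - 4 * α * (1 + c)
        ∧ (1 / L) ∈ I ∩ Set.Ioc 0 (1 / L)
        ∧ IsMinOn mfun (I ∩ Set.Ioc 0 (1 / L)) (1 / L)
        ∧ mfun (1 / L) = (κ + 4 * α) / (c - 4 * α * (1 + c))) := by
  have hL : 0 < L := lt_of_lt_of_le hμ hμL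
  have hα0 : 0 < α := by
    have h1 : (b : ℝ) < n := by exact_mod_cast hbn
    have h2 : (1 : ℝ) ≤ b := by exact_mod_cast hb1
    rw [hα]
    apply div_pos (by linarith)
    apply mul_pos <;> linarith
  clear hα
  obtain ⟨S, hS⟩ : ∃ S, S = Real.sqrt (((1 + c) / (c * μ)) ^ 2 + 1 / (4 * μ * α * L)) := ⟨_, rfl⟩
  obtain ⟨p, hp⟩ : ∃ p, p = (1 + c) / (c * μ) := ⟨_, rfl⟩
  obtain ⟨A, hA⟩ : ∃ A, A = 4 * α * L := ⟨_, rfl⟩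
  have hA0 : 0 < A := by rw [hA]; positivity
  have hp0 : 0 < p := by rw [hp]; positivity
  have hpm : p * (c * μ) = 1 + c := by rw [hp]; field_simp
  have hS0 : 0 ≤ S := by rw [hS]; positivity
  have hSS : S ^ 2 = p ^ 2 + 1 / (μ * A) := by
    rw [hS, Real.sq_sqrt (by positivity), hp, hA]
    congr 2
    ring
  have hSS2 : (S ^ 2 - p ^ 2) * (μ * A) = 1 := by
    rw [hSS]; field_simp; ring
  rw [← hS, ← hp] at hhtil
  have hpS : p < S := by
    apply lt_of_pow_lt_pow_left₀ 2 hS0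
    rw [hSS]
    have : 0 < 1 / (μ * A) := by positivity
    linarith
  have ht0 : 0 < htil := by linarith
  have hroot : c * μ * A * htil ^ 2 + 2 * (1 + c) * A * htil = c := by
    rw [← hpm, hhtil]
    linear_combination c * hSS2
  have hbd : ∀ h, h < 1 / (4 * α * L) * (c / (c + 1)) ↔ 0 < c - A * h * (1 + c) := by
    intro h
    rw [← hA, div_mul_div_comm, lt_div_iff₀ (by positivity)]
    constructor <;> intro h <;> linarith
  have hmf : ∀ h, mfun h = (1 + A * μ * h ^ 2) / (μ * (h * (c - A * h * (1 + c)))) := by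
    intro h
    rw [hmfun, hA]
    congr 1 <;> ring
  have htD : 0 < c - A * htil * (1 + c) := by
    have h1 : 0 < c * μ * A * htil ^ 2 := by positivity
    have h2 : 0 < A * htil * (1 + c) := by positivity
    linarith
  have htI : htil ∈ I := by
    rw [hI]; exact ⟨ht0, (hbd _).2 htD⟩
  have key : ∀ s h, 0 < s → 0 < h → 0 < c - A * s * (1 + c) → 0 < c - A * h * (1 + c) →
      0 ≤ (h - s) * (-c + A * (1 + c) * (h + s) + A * μ * c * h * s) → mfun s ≤ mfun h := by
    intro s h hs hh hsD hhD hk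
    rw [hmf, hmf, div_le_div_iff₀ (by positivity) (by positivity)]
    have := mul_nonneg hμ.le hk
    nlinarith [this]
  refine ⟨htI, ?_, ?_⟩
  · intro hle
    refine ⟨⟨htI, ht0, hle⟩, ?_, ?_⟩
    · rintro h ⟨hh, -⟩
      rw [hI] at hh
      refine key _ _ ht0 hh.1 htD ((hbd _).1 hh.2) ?_
      have h1 : 0 ≤ (A * (1 + c) + A * μ * c * htil) * (h - htil) ^ 2 := by positivity
      refine h1.trans_eq ?_
      linear_combination (htil - h) * hroot
    · have hsq : Real.sqrt (4 * α / κ + (1 + 1 / c) ^ 2 * (4 * α) ^ 2) = 4 * α * μ * S := by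
        rw [← Real.sqrt_sq (show 0 ≤ 4 * α * μ * S by positivity)]
        congr 1
        rw [mul_pow _ S, hSS, hp, hκ, hA]
        field_simp
        ring
      have hval : mfun htil = 2 / (c * μ * htil) := by
        rw [hmf, div_eq_div_iff (by positivity) (by positivity)]
        linear_combination μ * htil * hroot
      have e1 : (1 + 1 / c) = p * μ := by rw [hp]; field_simp; ring
      rw [hsq, hval, e1, hκ, div_eq_iff (by positivity), hhtil]
      have e2 : 2 * (L / μ) / c * (p * μ * (4 * α) + 4 * α * μ * S) * (c * μ * (S - p))
        = 2 * ((S ^ 2 - p ^ 2) * (μ * A)) := by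
        rw [hA]; field_simp; ring
      rw [e2, hSS2]; norm_num
  · intro hlt
    have hl0 : 0 < 1 / L := by positivity
    have hAL : A * (1 / L) = 4 * α := by rw [hA]; field_simp
    have hlD : 0 < c - A * (1 / L) * (1 + c) := by
      have : A * (1 / L) * (1 + c) ≤ A * htil * (1 + c) := by gcongr
      linarith
    refine ⟨by rw [← hAL]; exact hlD, ⟨?_, hl0, le_rfl⟩, ?_, ?_⟩
    · rw [hI]; exact ⟨hl0, (hbd _).2 hlD⟩
    · rintro h ⟨hh, hh2⟩
      rw [hI] at hh
      have h0 := hh.1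
      have hle := hh2.2
      refine key _ _ hl0 h0 hlD ((hbd _).1 hh.2) ?_
      apply mul_nonneg_of_nonpos_of_nonpos
      · linarith
      · have h1 : A * (1 + c) * (h + 1 / L) ≤ A * (1 + c) * (htil + htil) := by
          have : h + 1 / L ≤ htil + htil := by linarith
          gcongr
        have h2 : A * μ * c * h * (1 / L) ≤ A * μ * c * htil * htil := by
          have : h ≤ htil := by linarith
          gcongr
        linarith
    · rw [hmf, hAL, hκ]
      rw [hAL] at hlD
      rw [div_eq_div_iff (by positivity) hlD.ne', hA]
      field_simp
end
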